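/- arXiv:1908.03865 — 3 statements merged into one kernel-verified Lean document; each statement's English description precedes it below -/
import Mathlib

section
/- Any linking of two ordered triangles in ℝ³ is combinatorially isotopic either to a linking of two triangles whose convex hulls are disjoint, or to a Hopf linking, i.e. an ordered pair of disjoint triangles (Δ1, Δ2) such that ⟨Δ1⟩ ∩ ∂Δ2 consists of exactly one point. -/
open scoped Matrix

noncomputable section

/-- A point of 3-space. -/
abbrev Pt : Type := Fin 3 → ℝ

/-- A (non-degenerate) triangle in 3-space, given by three affinely independent vertices. -/
structure Tri where
  A : Pt
  B : Pt
  C : Pt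
  indep : AffineIndependent ℝ ![A, B, C]

namespace Tri

/-- The set of vertices of a triangle. -/
def vertexSet (T : Tri) : Set Pt := {T.A, T.B, T.C}

/-- The outline `∂T` of a triangle: the union of the three closed edges. -/
def outline (T : Tri) : Set Pt :=
  segment ℝ T.A T.B ∪ segment ℝ T.B T.C ∪ segment ℝ T.C T.A

/-- The convex hull `⟨T⟩` of a triangle. -/
def hull (T : Tri) : Set Pt := convexHull ℝ {T.A, T.B, T.C}

end Tri

/-- A family of triangles is a linking if the outlines are pairwise disjoint. -/
def IsLinking {ι : Type*} (T : ι → Tri) : Prop :=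
  ∀ i j, i ≠ j → Disjoint (T i).outline (T j).outline

/-- An elementary move replaces one triangle `ABC` of the family by `ABC'`, where `C'` is a
point not on the line `AB` such that `(⟨A,C,C'⟩ ∪ ⟨B,C,C'⟩) ∩ ∂XYZ = ∅` for every other
triangle `XYZ` of the family. -/
def ElemMove {ι : Type*} (T T' : ι → Tri) : Prop :=
  ∃ (i : ι) (A B C C' : Pt),
    (T i).vertexSet = {A, B, C} ∧
    (T' i).vertexSet = {A, B, C'} ∧
    C' ∉ affineSpan ℝ ({A, B} : Set Pt) ∧
    ∀ j, j ≠ i →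
      (convexHull ℝ ({A, C, C'} : Set Pt) ∪ convexHull ℝ ({B, C, C'} : Set Pt))
          ∩ (T j).outline = ∅ ∧
      T' j = T j

/-- Two families of triangles are combinatorially isotopic if one can be obtained from the
other by a finite sequence of elementary moves. -/
def CombIsotopic {ι : Type*} (T T' : ι → Tri) : Prop :=
  Relation.ReflTransGen ElemMove T T'

open Function in
theorem aux_move {T : Fin 2 → Tri} {i : Fin 2} {A B C C' : Pt}
    (hv : (T i).vertexSet = {A, B, C}) (h' : AffineIndependent ℝ ![A, B, C'])
    (hd : ∀ j, j ≠ i → Disjoint (convexHull ℝ ({A, C, C'} : Set Pt)) (T j).outline)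
    (hd' : ∀ j, j ≠ i → Disjoint (convexHull ℝ ({B, C, C'} : Set Pt)) (T j).outline) :
    ElemMove T (Function.update T i ⟨A, B, C', h'⟩) := by
  refine ⟨i, A, B, C, C', hv, ?_, ?_, ?_⟩
  · simp [Tri.vertexSet]
  · intro hmem
    rw [affineIndependent_iff_not_collinear_set] at h'
    apply h'
    have := collinear_insert_of_mem_affineSpan_pair hmem
    convert this using 1
    ext x; simp; tauto
  · intro j hj
    refine ⟨?_, by simp [hj]⟩
    rw [← Set.disjoint_iff_inter_eq_empty, Set.disjoint_union_left]
    exact ⟨hd j hj, hd' j hj⟩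

theorem aux_hull (T : Tri) : T.hull = convexHull ℝ T.vertexSet := rfl

theorem aux_outline_sub (T : Tri) : T.outline ⊆ T.hull := by
  have h : ∀ x ∈ ({T.A, T.B, T.C} : Set Pt), ∀ y ∈ ({T.A, T.B, T.C} : Set Pt),
      segment ℝ x y ⊆ T.hull := fun x hx y hy =>
    (convex_convexHull ℝ _).segment_subset (subset_convexHull ℝ _ hx) (subset_convexHull ℝ _ hy)
  unfold Tri.outline
  refine Set.union_subset (Set.union_subset ?_ ?_) ?_ <;> apply h <;> simp

theorem aux_ind {A B C : Pt} (hne : A ≠ B) (h : C ∉ affineSpan ℝ ({A, B} : Set Pt)) :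
    AffineIndependent ℝ ![A, B, C] := by
  rw [affineIndependent_iff_not_collinear_set]
  intro hc
  exact h (hc.mem_affineSpan_of_mem_of_ne (by simp) (by simp) (by simp) hne)

theorem aux_notMem {A B C : Pt} (h : AffineIndependent ℝ ![A, B, C]) :
    C ∉ affineSpan ℝ ({A, B} : Set Pt) := by
  rw [affineIndependent_iff_not_collinear_set] at h
  intro hm
  apply h
  have := collinear_insert_of_mem_affineSpan_pair hm
  convert this using 1
  ext x; simp; tauto

theorem aux_swap {A B C : Pt} (h : AffineIndependent ℝ ![A, B, C]) :
    AffineIndependent ℝ ![A, C, B] := by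
  rw [affineIndependent_iff_not_collinear_set] at h ⊢
  convert h using 3
  ext x; simp; tauto

theorem aux_rot {A B C : Pt} (h : AffineIndependent ℝ ![A, B, C]) :
    AffineIndependent ℝ ![B, C, A] := by
  rw [affineIndependent_iff_not_collinear_set] at h ⊢
  convert h using 2
  ext x; simp; tauto

theorem aux_ne {A B C : Pt} (h : AffineIndependent ℝ ![A, B, C]) : A ≠ B := by
  intro hh
  have := h.injective (a₁ := 0) (a₂ := 1) (by simpa using hh)
  simp at this

theorem aux_shrink_ind {A B C : Pt} (h : AffineIndependent ℝ ![A, B, C]) {t : ℝ} (ht : t ≠ 0) :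
    AffineIndependent ℝ ![A, B, AffineMap.lineMap A C t] := by
  have h2 := aux_notMem h
  apply aux_ind (aux_ne h)
  intro hm
  apply h2
  have hA : A ∈ affineSpan ℝ ({A, B} : Set Pt) := subset_affineSpan ℝ _ (by simp)
  have := AffineMap.lineMap_mem (t⁻¹) hA hm
  have e : AffineMap.lineMap A (AffineMap.lineMap A C t) t⁻¹ = C := by
    simp [AffineMap.lineMap_apply, smul_smul, ht]
  rwa [e] at this

/-- shrinking -/
theorem aux_shrink (T : Fin 2 → Tri) (i j : Fin 2) (hij : ∀ k, k ≠ i → k = j) (hne : j ≠ i)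
    {A B C : Pt} (hv : (T i).vertexSet = {A, B, C}) (hind : AffineIndependent ℝ ![A, B, C])
    (hd : Disjoint (T i).hull (T j).outline) (hA : A ∉ (T j).hull) :
    ∃ T' : Fin 2 → Tri, CombIsotopic T T' ∧ Disjoint (T' i).hull (T' j).hull := by
  have hcl : IsClosed (T j).hull := by
    apply IsCompact.isClosed
    apply Set.Finite.isCompact_convexHull
    exact Set.toFinite _
  obtain ⟨r, hr, hball⟩ := Metric.isOpen_iff.1 hcl.isOpen_compl A hA
  have hsm : ∀ X : Pt, ∃ t : ℝ, 0 < t ∧ t ≤ 1 ∧ AffineMap.lineMap A X t ∈ Metric.ball A r := by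
    intro X
    refine ⟨min 1 (r / (2 * (dist A X + 1))), ?_, min_le_left _ _, ?_⟩
    · have := dist_nonneg (x := A) (y := X); positivity
    · have h0 := dist_nonneg (x := A) (y := X)
      rw [Metric.mem_ball, dist_lineMap_left, Real.norm_eq_abs, abs_of_nonneg (by positivity)]
      have h1 : min 1 (r / (2 * (dist A X + 1))) ≤ r / (2 * (dist A X + 1)) := min_le_right _ _
      have h2 : r / (2 * (dist A X + 1)) * dist A X < r := by
        rw [div_mul_eq_mul_div, div_lt_iff₀ (by positivity)]
        nlinarith
      calc _ ≤ _ := mul_le_mul_of_nonneg_right h1 h0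
        _ < r := h2
  obtain ⟨s, hs0, hs1, hsb⟩ := hsm C
  obtain ⟨t, ht0, ht1, htb⟩ := hsm B
  set C' : Pt := AffineMap.lineMap A C s with hC'
  set B' : Pt := AffineMap.lineMap A B t with hB'
  have hconv : Convex ℝ (T i).hull := convex_convexHull ℝ _
  have mA : A ∈ (T i).hull := subset_convexHull ℝ _ (by change A ∈ (T i).vertexSet; simp [hv])
  have mB : B ∈ (T i).hull := subset_convexHull ℝ _ (by change B ∈ (T i).vertexSet; simp [hv])
  have mC : C ∈ (T i).hull := subset_convexHull ℝ _ (by change C ∈ (T i).vertexSet; simp [hv])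
  have mC' : C' ∈ (T i).hull := hconv.lineMap_mem mA mC ⟨hs0.le, hs1⟩
  have mB' : B' ∈ (T i).hull := hconv.lineMap_mem mA mB ⟨ht0.le, ht1⟩
  have hsub : ∀ X ∈ (T i).hull, ∀ Y ∈ (T i).hull, ∀ Z ∈ (T i).hull,
      Disjoint (convexHull ℝ ({X, Y, Z} : Set Pt)) (T j).outline := by
    intro X hX Y hY Z hZ
    refine hd.mono_left (convexHull_min ?_ hconv)
    rintro x (rfl | rfl | rfl) <;> assumption
  have i1 : AffineIndependent ℝ ![A, B, C'] := aux_shrink_ind hind hs0.ne'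
  have i2 : AffineIndependent ℝ ![A, C', B'] := aux_shrink_ind (aux_swap i1) ht0.ne'
  have m1 : ElemMove T (Function.update T i ⟨A, B, C', i1⟩) := by
    apply aux_move hv i1
    · intro k hk; rw [hij k hk]; exact hsub _ mA _ mC _ mC'
    · intro k hk; rw [hij k hk]; exact hsub _ mB _ mC _ mC'
  have m2 : ElemMove (Function.update T i ⟨A, B, C', i1⟩)
      (Function.update (Function.update T i ⟨A, B, C', i1⟩) i ⟨A, C', B', i2⟩) := by
    apply aux_move (C := B) _ i2
    · intro k hk; rw [hij k hk, Function.update_of_ne hne]; exact hsub _ mA _ mB _ mB'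
    · intro k hk; rw [hij k hk, Function.update_of_ne hne]; exact hsub _ mC' _ mB _ mB'
    · simp only [Function.update_self, Tri.vertexSet]
      rw [Set.pair_comm B C']
  refine ⟨_, (Relation.ReflTransGen.single m1).tail m2, ?_⟩
  simp only [Function.update_self, Function.update_of_ne hne]
  rw [Set.disjoint_left]
  intro x hx
  apply hball
  refine convexHull_min ?_ (convex_ball A r) hx
  rintro x (rfl | rfl | rfl)
  · exact Metric.mem_ball_self hr
  · exact hsb
  · exact htb

theorem aux_outline_of_segment {T : Tri} {X Y : Pt} (hX : X ∈ T.vertexSet) (hY : Y ∈ T.vertexSet) :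
    segment ℝ X Y ⊆ T.outline := by
  have hl : ∀ P Q : Pt, P ∈ segment ℝ P Q := left_mem_segment ℝ
  have e1 := segment_symm ℝ T.A T.B
  have e2 := segment_symm ℝ T.B T.C
  have e3 := segment_symm ℝ T.C T.A
  intro x hx
  unfold Tri.outline
  have a1 := hl T.A T.B
  have a2 := hl T.B T.C
  have a3 := hl T.C T.A
  rcases hX with rfl | rfl | rfl <;> rcases hY with rfl | rfl | rfl <;>
    simp only [segment_same, Set.mem_singleton_iff, Set.mem_union] at * <;>
    first
    | (subst hx; tauto)
    | (simp_all)

/-- A segment-cone over a set in a plane, apex off the plane. -/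
theorem aux_cone {P : AffineSubspace ℝ Pt} {X Y Z x : Pt} (hX : X ∈ P) (hY : Y ∈ P) (hZ : Z ∉ P)
    (hx : x ∈ convexHull ℝ ({X, Y, Z} : Set Pt)) (hxP : x ∈ P) : x ∈ segment ℝ X Y := by
  have e : ({X, Y, Z} : Set Pt) = {Z, X, Y} := by ext; simp; tauto
  rw [e, convexHull_insert (by simp), convexHull_pair, mem_convexJoin] at hx
  obtain ⟨z, hz, y, hy, hxy⟩ := hx
  rw [Set.mem_singleton_iff] at hz
  subst hz
  have hyP : y ∈ P := P.convex.segment_subset hX hY hy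
  rw [segment_eq_image_lineMap] at hxy
  obtain ⟨t, ht, rfl⟩ := hxy
  by_cases h1 : t = 1
  · subst h1; simpa using hy
  · exfalso
    apply hZ
    have h2 : (1 - t) ≠ 0 := sub_ne_zero.2 (Ne.symm h1)
    have := AffineMap.lineMap_mem ((1 - t)⁻¹) hyP hxP
    convert this
    rw [← AffineMap.lineMap_apply_one_sub y z t]
    simp [AffineMap.lineMap_apply, smul_smul, h2]

theorem aux_finrank (T : Tri) :
    Module.finrank ℝ (affineSpan ℝ T.vertexSet).direction = 2 := by
  have := T.indep.finrank_vectorSpan (n := 2) (by simp)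
  rw [direction_affineSpan]
  have e : T.vertexSet = Set.range ![T.A, T.B, T.C] := by
    ext x
    simp only [Tri.vertexSet, Set.mem_insert_iff, Set.mem_singleton_iff, Set.mem_range,
      Fin.exists_fin_succ]
    simp [eq_comm]
  rw [e]
  exact this

theorem aux_coplanar (T : Fin 2 → Tri) (hT : IsLinking T)
    (h : affineSpan ℝ (T 0).vertexSet = affineSpan ℝ (T 1).vertexSet) :
    ∃ T' : Fin 2 → Tri, CombIsotopic T T' ∧ Disjoint (T' 0).hull (T' 1).hull := by
  set P := affineSpan ℝ (T 0).vertexSet with hP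
  obtain ⟨Z, hZ⟩ : ∃ Z, Z ∉ P := by
    by_contra! hall
    have : P = ⊤ := by
      ext x; simp [hall x]
    have h2 := aux_finrank (T 0)
    rw [← hP, this] at h2
    rw [AffineSubspace.direction_top, finrank_top] at h2
    simp at h2
  have hsub : (T 1).hull ⊆ P := by
    rw [h]
    exact convexHull_subset_affineSpan _
  have mA : (T 0).A ∈ P := subset_affineSpan ℝ _ (by simp [Tri.vertexSet])
  have mB : (T 0).B ∈ P := subset_affineSpan ℝ _ (by simp [Tri.vertexSet])
  have mC : (T 0).C ∈ P := subset_affineSpan ℝ _ (by simp [Tri.vertexSet])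
  have hdis := hT 0 1 (by simp)
  have key : ∀ X ∈ (T 0).vertexSet, ∀ Y ∈ (T 0).vertexSet,
      Disjoint (convexHull ℝ ({X, Y, Z} : Set Pt)) (T 1).outline := by
    intro X hX Y hY
    rw [Set.disjoint_left]
    intro x hx hx1
    refine Set.disjoint_left.1 hdis (aux_outline_of_segment hX hY ?_) hx1
    exact aux_cone (subset_affineSpan ℝ _ hX) (subset_affineSpan ℝ _ hY) hZ hx
      (hsub (aux_outline_sub _ hx1))
  have hind : AffineIndependent ℝ ![(T 0).A, (T 0).B, Z] := by
    apply aux_ind (aux_ne (T 0).indep)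
    intro hm
    apply hZ
    refine affineSpan_mono ℝ ?_ hm
    intro x; simp [Tri.vertexSet]; tauto
  have hfin : ∀ k : Fin 2, k ≠ 0 → k = 1 := by decide
  have m1 : ElemMove T (Function.update T 0 ⟨(T 0).A, (T 0).B, Z, hind⟩) := by
    apply aux_move (C := (T 0).C) rfl hind
    · intro k hk; rw [hfin k hk]; apply key <;> simp [Tri.vertexSet]
    · intro k hk; rw [hfin k hk]; apply key <;> simp [Tri.vertexSet]
  obtain ⟨T', h1, h2⟩ := aux_shrink (Function.update T 0 ⟨(T 0).A, (T 0).B, Z, hind⟩) 0 1 hfin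
    (by simp) (A := Z) (B := (T 0).A) (C := (T 0).B) (by
      simp only [Function.update_self, Tri.vertexSet]; ext; simp; tauto)
    (aux_rot (aux_rot hind))
    (by
      rw [Function.update_of_ne (show (1 : Fin 2) ≠ 0 by decide), Function.update_self]
      apply key <;> simp [Tri.vertexSet])
    (by
      rw [Function.update_of_ne (show (1 : Fin 2) ≠ 0 by decide)]
      exact fun hh => hZ (hsub hh))
  exact ⟨T', (Relation.ReflTransGen.single m1).trans h1, h2⟩

theorem aux_span_eq (S T : Tri) (h : S.vertexSet ⊆ T.hull) :
    affineSpan ℝ S.vertexSet = affineSpan ℝ T.vertexSet := by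
  have hle : affineSpan ℝ S.vertexSet ≤ affineSpan ℝ T.vertexSet :=
    affineSpan_le.2 (h.trans (convexHull_subset_affineSpan _))
  apply AffineSubspace.eq_of_direction_eq_of_nonempty_of_le _ _ hle
  · apply Submodule.eq_of_le_of_finrank_eq (AffineSubspace.direction_le hle)
    rw [aux_finrank, aux_finrank]
  · exact ⟨S.A, subset_affineSpan ℝ _ (by simp [Tri.vertexSet])⟩

theorem aux_zero (T : Fin 2 → Tri) (i j : Fin 2) (hij : ∀ k, k ≠ i → k = j) (hne : j ≠ i)
    (hcop : affineSpan ℝ (T i).vertexSet ≠ affineSpan ℝ (T j).vertexSet)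
    (hd : Disjoint (T i).hull (T j).outline) :
    ∃ T' : Fin 2 → Tri, CombIsotopic T T' ∧ Disjoint (T' i).hull (T' j).hull := by
  have : ¬ (T i).vertexSet ⊆ (T j).hull := fun h => hcop (aux_span_eq _ _ h)
  rw [Set.not_subset] at this
  obtain ⟨X, hX, hX'⟩ := this
  have hi := (T i).indep
  rcases hX with rfl | rfl | rfl
  · exact aux_shrink T i j hij hne (A := (T i).A) (B := (T i).B) (C := (T i).C) rfl hi hd hX'
  · exact aux_shrink T i j hij hne (by unfold Tri.vertexSet; ext; simp; tauto) (aux_rot hi) hd hX'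
  · exact aux_shrink T i j hij hne (by unfold Tri.vertexSet; ext; simp; tauto)
      (aux_rot (aux_rot hi)) hd hX'

theorem aux_mem_hull {A B C x : Pt} : x ∈ convexHull ℝ ({A, B, C} : Set Pt) ↔
    ∃ a b c : ℝ, 0 ≤ a ∧ 0 ≤ b ∧ 0 ≤ c ∧ a + b + c = 1 ∧ a • A + b • B + c • C = x := by
  constructor
  · intro h
    rw [convexHull_insert (by simp), convexHull_pair, mem_convexJoin] at h
    obtain ⟨z, hz, y, ⟨p, q, hp, hq, hpq, rfl⟩, ⟨u, v, hu, hv, huv, rfl⟩⟩ := h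
    rw [Set.mem_singleton_iff] at hz
    subst hz
    refine ⟨u, v * p, v * q, hu, by positivity, by positivity, ?_, ?_⟩
    · linear_combination huv + v * hpq
    · module
  · rintro ⟨a, b, c, ha, hb, hc, h, rfl⟩
    have hconv := convex_convexHull ℝ ({A, B, C} : Set Pt)
    have := hconv.sum_mem (t := Finset.univ) (w := ![a, b, c]) (z := ![A, B, C])
      (by intro i _; fin_cases i <;> simpa) (by simp [Fin.sum_univ_three, h])
      (by intro i _; apply subset_convexHull; fin_cases i <;> simp)
    simpa [Fin.sum_univ_three] using this

theorem aux_unique {A B C : Pt} (h : AffineIndependent ℝ ![A, B, C]) {a b c a' b' c' : ℝ}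
    (h1 : a + b + c = 1) (h2 : a' + b' + c' = 1)
    (e : a • A + b • B + c • C = a' • A + b' • B + c' • C) : c = c' := by
  rw [affineIndependent_iff_eq_of_fintype_affineCombination_eq] at h
  have := h ![a, b, c] ![a', b', c'] (by simp [Fin.sum_univ_three, h1])
    (by simp [Fin.sum_univ_three, h2]) (by
      rw [Finset.affineCombination_eq_linear_combination _ _ _ (by simp [Fin.sum_univ_three, h1]),
        Finset.affineCombination_eq_linear_combination _ _ _ (by simp [Fin.sum_univ_three, h2])]
      simpa [Fin.sum_univ_three] using e)
  exact congrFun this 2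

theorem aux_extreme_edge {A B C : Pt} (h : AffineIndependent ℝ ![A, B, C]) {x y p : Pt}
    (hx : x ∈ convexHull ℝ ({A, B, C} : Set Pt)) (hy : y ∈ convexHull ℝ ({A, B, C} : Set Pt))
    (hp : p ∈ segment ℝ A B) (hxy : p ∈ openSegment ℝ x y) : x ∈ segment ℝ A B := by
  rw [aux_mem_hull] at hx hy
  obtain ⟨a, b, c, ha, hb, hc, h1, rfl⟩ := hx
  obtain ⟨a', b', c', ha', hb', hc', h1', rfl⟩ := hy
  obtain ⟨p1, p2, hp1, hp2, hp12, rfl⟩ := hp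
  obtain ⟨u, v, hu, hv, huv, e⟩ := hxy
  have := aux_unique h (a := u * a + v * a') (b := u * b + v * b') (c := u * c + v * c')
    (a' := p1) (b' := p2) (c' := 0) (by linear_combination u * h1 + v * h1' + huv)
    (by linear_combination hp12) (by rw [zero_smul, add_zero, ← e]; module)
  have hc0 : c = 0 := by
    have q1 : 0 ≤ u * c := by positivity
    have q2 : 0 ≤ v * c' := by positivity
    have q3 : u * c = 0 := by linarith
    rcases mul_eq_zero.1 q3 with q | q
    · exact absurd q hu.ne'
    · exact q
  subst hc0
  exact ⟨a, b, ha, hb, by linarith, by simp⟩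

theorem aux_extreme (T : Tri) {x y p : Pt} (hx : x ∈ T.hull) (hy : y ∈ T.hull)
    (hp : p ∈ T.outline) (hxy : p ∈ openSegment ℝ x y) : x ∈ T.outline := by
  have r1 : T.hull = convexHull ℝ {T.B, T.C, T.A} := by
    unfold Tri.hull; congr 1; ext; simp; tauto
  have r2 : T.hull = convexHull ℝ {T.C, T.A, T.B} := by
    unfold Tri.hull; congr 1; ext; simp; tauto
  have hi := T.indep
  rcases hp with (hp | hp) | hp
  · exact Or.inl (Or.inl (aux_extreme_edge hi hx hy hp hxy))
  · rw [r1] at hx hy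
    exact Or.inl (Or.inr (aux_extreme_edge (aux_rot hi) hx hy hp hxy))
  · rw [r2] at hx hy
    exact Or.inr (aux_extreme_edge (aux_rot (aux_rot hi)) hx hy hp hxy)

theorem aux_main_unique (S T : Tri) (hST : Disjoint S.outline T.outline)
    (hcop : affineSpan ℝ S.vertexSet ≠ affineSpan ℝ T.vertexSet)
    {p q r : Pt} (hp : p ∈ S.hull) (hp' : p ∈ T.outline) (hq : q ∈ S.hull) (hq' : q ∈ T.outline)
    (hr : r ∈ T.hull) (hr' : r ∈ S.outline) : p = q := by
  by_contra hpq
  have hpr : p ≠ r := fun h => Set.disjoint_left.1 hST hr' (h ▸ hp')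
  have hqr : q ≠ r := fun h => Set.disjoint_left.1 hST hr' (h ▸ hq')
  have hcol : Collinear ℝ ({p, q, r} : Set Pt) := by
    by_contra hc
    rw [← affineIndependent_iff_not_collinear_set] at hc
    let U : Tri := ⟨p, q, r, hc⟩
    apply hcop
    rw [← aux_span_eq U S, ← aux_span_eq U T]
    · rintro x (rfl | rfl | rfl)
      exacts [aux_outline_sub _ hp', aux_outline_sub _ hq', hr]
    · rintro x (rfl | rfl | rfl)
      exacts [hp, hq, aux_outline_sub _ hr']
  have hop : ∀ {a b c : Pt}, Wbtw ℝ a b c → b ≠ a → b ≠ c → b ∈ openSegment ℝ a c := by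
    intro a b c h h1 h2
    exact mem_openSegment_of_ne_left_right h1.symm h2.symm h.mem_segment
  rcases hcol.wbtw_or_wbtw_or_wbtw with h | h | h
  · have := hop h.symm hqr (Ne.symm hpq)
    exact Set.disjoint_left.1 hST hr' (aux_extreme T hr (aux_outline_sub _ hp') hq' this)
  · have := hop h hqr.symm hpr.symm
    rw [openSegment_symm] at this
    exact Set.disjoint_left.1 hST (aux_extreme S hp hq hr' this) hp'
  · have := hop h hpr hpq
    exact Set.disjoint_left.1 hST hr' (aux_extreme T hr (aux_outline_sub _ hq') hp' this)

theorem aux_linking (T : Fin 2 → Tri) (h : Disjoint (T 0).hull (T 1).hull) : IsLinking T := by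
  have h' := h.mono (aux_outline_sub _) (aux_outline_sub _)
  intro i j hij
  fin_cases i <;> fin_cases j
  · exact absurd rfl hij
  · exact h'
  · exact h'.symm
  · exact absurd rfl hij

/-- Any linking of two ordered triangles is combinatorially isotopic either to a linking of
two triangles whose convex hulls are disjoint, or to a Hopf linking. -/
theorem stmt0 (T : Fin 2 → Tri) (hT : IsLinking T) :
    (∃ T' : Fin 2 → Tri, IsLinking T' ∧ CombIsotopic T T' ∧
      Disjoint (T' 0).hull (T' 1).hull) ∨
    (∃ T' : Fin 2 → Tri, IsLinking T' ∧ CombIsotopic T T' ∧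
      ∃ p : Pt, (T' 0).hull ∩ (T' 1).outline = {p}) := by
  by_cases hcop : affineSpan ℝ (T 0).vertexSet = affineSpan ℝ (T 1).vertexSet
  · obtain ⟨T', h1, h2⟩ := aux_coplanar T hT hcop
    exact Or.inl ⟨T', aux_linking T' h2, h1, h2⟩
  by_cases h01 : Disjoint (T 0).hull (T 1).outline
  · obtain ⟨T', h1, h2⟩ := aux_zero T 0 1 (by decide) (by decide) hcop h01
    exact Or.inl ⟨T', aux_linking T' h2, h1, h2⟩
  by_cases h10 : Disjoint (T 1).hull (T 0).outline
  · obtain ⟨T', h1, h2⟩ := aux_zero T 1 0 (by decide) (by decide) (Ne.symm hcop) h10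
    exact Or.inl ⟨T', aux_linking T' h2.symm, h1, h2.symm⟩
  rw [Set.not_disjoint_iff] at h01 h10
  obtain ⟨p, hp, hp'⟩ := h01
  obtain ⟨r, hr, hr'⟩ := h10
  refine Or.inr ⟨T, hT, Relation.ReflTransGen.refl, p, ?_⟩
  ext q
  constructor
  · rintro ⟨hq, hq'⟩
    exact aux_main_unique (T 0) (T 1) (hT 0 1 (by decide)) hcop hq hq' hp hp' hr hr'
  · rintro rfl
    exact ⟨hp, hp'⟩
end
end

section
/- For any linking (Δ1, Δ2) of two ordered triangles in ℝ³, the ordered linking (Δ1, Δ2) is combinatorially isotopic to the ordered linking (Δ2, Δ1). -/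
open scoped Matrix

noncomputable section

/-! ### Basic facts -/

def NC (A B C : Pt) : Prop :=
  ∀ a b c : ℝ, a + b + c = 0 → a • A + b • B + c • C = 0 → a = 0 ∧ b = 0 ∧ c = 0

lemma nc_iff (A B C : Pt) : AffineIndependent ℝ ![A, B, C] ↔ NC A B C := by
  rw [affineIndependent_iff]
  constructor
  · intro h a b c h0 h1
    have := h Finset.univ ![a, b, c] (by simpa [Fin.sum_univ_three] using h0)
      (by simpa [Fin.sum_univ_three] using h1)
    exact ⟨by simpa using this 0 (by simp), by simpa using this 1 (by simp),
      by simpa using this 2 (by simp)⟩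
  · intro h s w h0 h1 e he
    classical
    let w' : Fin 3 → ℝ := fun i => if i ∈ s then w i else 0
    have e0 : ∑ i, w' i = 0 := by
      simp only [w', Finset.sum_ite_mem, Finset.univ_inter]; exact h0
    have e1 : ∑ i, w' i • (![A, B, C] i) = 0 := by
      simp only [w', ite_smul, zero_smul, Finset.sum_ite_mem, Finset.univ_inter]; exact h1
    rw [Fin.sum_univ_three] at e0 e1
    have := h _ _ _ e0 (by simpa using e1)
    have hw : w e = w' e := by simp [w', he]
    rw [hw]
    fin_cases e
    · exact this.1
    · exact this.2.1
    · exact this.2.2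

lemma NC.perm1 {A B C : Pt} (h : NC A B C) : NC B C A := by
  intro a b c h0 h1
  obtain ⟨x, y, z⟩ := h c a b (by linarith) (by rw [← h1]; abel)
  exact ⟨y, z, x⟩

lemma NC.perm2 {A B C : Pt} (h : NC A B C) : NC B A C := by
  intro a b c h0 h1
  obtain ⟨x, y, z⟩ := h b a c (by linarith) (by rw [← h1]; abel)
  exact ⟨y, x, z⟩

lemma NC.ne {A B C : Pt} (h : NC A B C) : A ≠ B := by
  rintro rfl
  have := h 1 (-1) 0 (by norm_num) (by simp)
  norm_num at this

lemma Tri.nc (s : Tri) : NC s.A s.B s.C := (nc_iff _ _ _).1 s.indep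

lemma nc_of_vs {s : Tri} {A B C : Pt} (h : s.vertexSet = {A, B, C}) : NC A B C := by
  have n := s.nc
  have h1 : s.A ≠ s.B := n.ne
  have h2 : s.B ≠ s.C := n.perm1.ne
  have h3 : s.C ≠ s.A := n.perm1.perm1.ne
  have a1 : s.A ∈ ({A, B, C} : Set Pt) := by rw [← h]; simp [Tri.vertexSet]
  have a2 : s.B ∈ ({A, B, C} : Set Pt) := by rw [← h]; simp [Tri.vertexSet]
  have a3 : s.C ∈ ({A, B, C} : Set Pt) := by rw [← h]; simp [Tri.vertexSet]
  simp only [Set.mem_insert_iff, Set.mem_singleton_iff] at a1 a2 a3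
  rcases a1 with a1 | a1 | a1 <;> rcases a2 with a2 | a2 | a2 <;>
    rcases a3 with a3 | a3 | a3 <;> first
    | exact absurd (a1.trans a2.symm) h1
    | exact absurd (a2.trans a3.symm) h2
    | exact absurd (a3.trans a1.symm) h3
    | (rw [a1, a2, a3] at n
       first
       | exact n
       | exact n.perm1
       | exact n.perm1.perm1
       | exact n.perm2
       | exact n.perm2.perm1
       | exact n.perm2.perm1.perm1)

lemma hull3 {A B C x : Pt} : x ∈ convexHull ℝ ({A, B, C} : Set Pt) ↔
    ∃ a b c : ℝ, 0 ≤ a ∧ 0 ≤ b ∧ 0 ≤ c ∧ a + b + c = 1 ∧ x = a • A + b • B + c • C := by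
  rw [convexHull_insert (by simp), convexHull_pair, mem_convexJoin]
  constructor
  · rintro ⟨y, hy, z, ⟨a, b, ha, hb, hab, rfl⟩, ⟨c, d, hc, hd, hcd, rfl⟩⟩
    rw [Set.mem_singleton_iff] at hy
    subst hy
    refine ⟨c, d * a, d * b, hc, by positivity, by positivity, ?_, ?_⟩
    · rw [add_assoc, ← mul_add, hab, mul_one, hcd]
    · simp only [smul_add, smul_smul, add_assoc]
  · rintro ⟨a, b, c, ha, hb, hc, h, rfl⟩
    by_cases h0 : b + c = 0
    · have hb0 : b = 0 := by linarith
      have hc0 : c = 0 := by linarith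
      have ha1 : a = 1 := by linarith
      subst hb0 hc0 ha1
      exact ⟨A, rfl, B, left_mem_segment _ _ _, by simpa using left_mem_segment ℝ A B⟩
    · refine ⟨A, rfl, (b / (b + c)) • B + (c / (b + c)) • C,
        ⟨b / (b + c), c / (b + c), by positivity, by positivity, by field_simp, rfl⟩,
        ⟨a, b + c, ha, by positivity, by linarith, ?_⟩⟩
      simp only [smul_add, smul_smul, add_assoc]
      congr 2
      · congr 1; field_simp
      · congr 1; field_simp

lemma outl_vs {s : Tri} {x : Pt} : x ∈ s.outline ↔
    ∃ P ∈ s.vertexSet, ∃ Q ∈ s.vertexSet, x ∈ segment ℝ P Q := by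
  simp only [Tri.outline, Tri.vertexSet, Set.mem_union, Set.mem_insert_iff,
    Set.mem_singleton_iff, exists_eq_or_imp, exists_eq_left]
  have hA := segment_same ℝ s.A
  have hB := segment_same ℝ s.B
  have hC := segment_same ℝ s.C
  have h1 := left_mem_segment ℝ s.A s.B
  have h2 := left_mem_segment ℝ s.B s.C
  have h3 := left_mem_segment ℝ s.C s.A
  rw [hA, hB, hC, segment_symm ℝ s.B s.A, segment_symm ℝ s.C s.B, segment_symm ℝ s.A s.C]
  simp only [Set.mem_singleton_iff]
  constructor
  · tauto
  · rintro ((rfl | h | h) | (h | rfl | h) | (h | h | rfl)) <;> tauto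

lemma outl {s : Tri} {A B C x : Pt} (h : s.vertexSet = {A, B, C}) : x ∈ s.outline ↔
    ∃ a b c : ℝ, 0 ≤ a ∧ 0 ≤ b ∧ 0 ≤ c ∧ a + b + c = 1 ∧ x = a • A + b • B + c • C ∧
      (a = 0 ∨ b = 0 ∨ c = 0) := by
  rw [outl_vs, h]
  constructor
  · rintro ⟨P, hP, Q, hQ, a, b, ha, hb, hab, rfl⟩
    simp only [Set.mem_insert_iff, Set.mem_singleton_iff] at hP hQ
    rcases hP with rfl | rfl | rfl <;> rcases hQ with rfl | rfl | rfl
    · exact ⟨1, 0, 0, by simp, by simp, by simp, by simp, by rw [← add_smul, hab]; simp, by simp⟩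
    · exact ⟨a, b, 0, ha, hb, le_rfl, by linarith, by simp, by simp⟩
    · exact ⟨a, 0, b, ha, le_rfl, hb, by linarith, by simp, by simp⟩
    · exact ⟨b, a, 0, hb, ha, le_rfl, by linarith, by simp [add_comm], by simp⟩
    · exact ⟨0, 1, 0, by simp, by simp, by simp, by simp, by rw [← add_smul, hab]; simp, by simp⟩
    · exact ⟨0, a, b, le_rfl, ha, hb, by linarith, by simp, by simp⟩
    · exact ⟨b, 0, a, hb, le_rfl, ha, by linarith, by simp [add_comm], by simp⟩
    · exact ⟨0, b, a, le_rfl, hb, ha, by linarith, by simp [add_comm], by simp⟩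
    · exact ⟨0, 0, 1, by simp, by simp, by simp, by simp, by rw [← add_smul, hab]; simp, by simp⟩
  · rintro ⟨a, b, c, ha, hb, hc, hs, rfl, rfl | rfl | rfl⟩
    · exact ⟨B, by simp, C, by simp, b, c, hb, hc, by linarith, by simp⟩
    · exact ⟨A, by simp, C, by simp, a, c, ha, hc, by linarith, by simp⟩
    · exact ⟨A, by simp, B, by simp, a, b, ha, hb, by linarith, by simp⟩

lemma notMem_span {A B C : Pt} (h : NC A B C) : C ∉ affineSpan ℝ ({A, B} : Set Pt) := by
  intro hc
  obtain ⟨r, hr⟩ := mem_affineSpan_pair_iff_exists_lineMap_eq.1 hc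
  have := h (1 - r) r (-1) (by ring) (by
    rw [← hr, AffineMap.lineMap_apply_module]; module)
  norm_num at this

lemma nc_of_notMem {A B C : Pt} (hAB : A ≠ B) (h : C ∉ affineSpan ℝ ({A, B} : Set Pt)) :
    NC A B C := by
  intro a b c h0 h1
  have hc : c = 0 := by
    by_contra hc
    apply h
    rw [mem_affineSpan_pair_iff_exists_lineMap_eq]
    refine ⟨-b / c, ?_⟩
    rw [AffineMap.lineMap_apply_module]
    have ha : a = -b - c := by linarith
    subst ha
    have : c • (((1 - -b / c) • A + (-b / c) • B) - C) = 0 := by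
      rw [smul_sub, smul_add, smul_smul, smul_smul]
      have e1 : c * (1 - -b / c) = -(-b - c) := by field_simp; ring
      have e2 : c * (-b / c) = -b := by field_simp
      rw [e1, e2, ← neg_eq_zero, ← h1]; simp only [neg_smul]; abel
    rcases smul_eq_zero.1 this with h | h
    · exact absurd h hc
    · exact sub_eq_zero.1 h
  subst hc
  have ha : a = -b := by linarith
  subst ha
  have : b • (B - A) = 0 := by rw [← h1, smul_sub]; simp only [neg_smul, zero_smul]; abel
  rcases smul_eq_zero.1 this with h | h
  · simp [h]
  · exact absurd (sub_eq_zero.1 h).symm hAB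

/-! ### Moves -/

def Mv (O : Set Pt) (s s' : Tri) : Prop :=
  ∃ A B C C' : Pt, s.vertexSet = {A, B, C} ∧ s'.vertexSet = {A, B, C'} ∧
    (∀ x ∈ convexHull ℝ ({A, C, C'} : Set Pt), x ∉ O) ∧
    (∀ x ∈ convexHull ℝ ({B, C, C'} : Set Pt), x ∉ O)

def M (O : Set Pt) : Tri → Tri → Prop := Relation.ReflTransGen (Mv O)

def P (s t s' t' : Tri) : Prop := CombIsotopic ![s, t] ![s', t']

lemma Mv.symm {O : Set Pt} {s s' : Tri} (h : Mv O s s') : Mv O s' s := by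
  obtain ⟨A, B, C, C', h1, h2, h3, h4⟩ := h
  refine ⟨A, B, C', C, h2, h1, ?_, ?_⟩
  · rwa [Set.pair_comm]
  · rwa [Set.pair_comm]

lemma M.symm {O : Set Pt} {s s' : Tri} (h : M O s s') : M O s' s := by
  induction h with
  | refl => exact Relation.ReflTransGen.refl
  | tail _ h ih => exact Relation.ReflTransGen.head h.symm ih

lemma P.trans {s t s' t' s'' t'' : Tri} (h : P s t s' t') (h' : P s' t' s'' t'') :
    P s t s'' t'' := Relation.ReflTransGen.trans h h'

lemma em_symm {T T' : Fin 2 → Tri} (h : ElemMove T T') : ElemMove T' T := by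
  obtain ⟨i, A, B, C, C', h1, h2, h3, h4⟩ := h
  refine ⟨i, A, B, C', C, h2, h1, notMem_span (nc_of_vs h1), fun j hj => ?_⟩
  obtain ⟨h5, h6⟩ := h4 j hj
  rw [h6, Set.pair_comm C' C]
  exact ⟨h5, rfl⟩

lemma P.symm {s t s' t' : Tri} (h : P s t s' t') : P s' t' s t := by
  unfold P CombIsotopic at *
  generalize ![s, t] = X at *
  generalize ![s', t'] = Y at *
  induction h with
  | refl => exact Relation.ReflTransGen.refl
  | tail _ h ih => exact Relation.ReflTransGen.head (em_symm h) ih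

lemma em_swap {T T' : Fin 2 → Tri} (h : ElemMove T T') :
    ElemMove (T ∘ Fin.rev) (T' ∘ Fin.rev) := by
  obtain ⟨i, A, B, C, C', h1, h2, h3, h4⟩ := h
  refine ⟨i.rev, A, B, C, C', by simpa using h1, by simpa using h2, h3, fun j hj => ?_⟩
  exact h4 j.rev (by rintro rfl; simp at hj)

lemma vec_rev (s t : Tri) : ![s, t] ∘ Fin.rev = ![t, s] := by
  funext i; fin_cases i <;> rfl

lemma P.swap {s t s' t' : Tri} (h : P s t s' t') : P t s t' s' := by
  have := Relation.ReflTransGen.lift (p := ElemMove) (fun T : Fin 2 → Tri => T ∘ Fin.rev)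
    (fun _ _ h => em_swap h) _ _ h
  simp only [Function.onFun, vec_rev] at this
  exact this

lemma M.left {s s' t : Tri} (h : M t.outline s s') : P s t s' t := by
  refine Relation.ReflTransGen.lift (fun s => ![s, t]) ?_ _ _ h
  rintro a b ⟨A, B, C, C', h1, h2, h3, h4⟩
  refine ⟨0, A, B, C, C', h1, h2, notMem_span (nc_of_vs h2), fun j hj => ?_⟩
  have : j = 1 := by fin_cases j <;> simp_all
  subst this
  refine ⟨?_, rfl⟩
  ext x
  simp only [Set.mem_inter_iff, Set.mem_union, Set.mem_empty_iff_false, iff_false]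
  rintro ⟨h | h, h'⟩
  · exact h3 x h h'
  · exact h4 x h h'

lemma M.right {s s' t : Tri} (h : M t.outline s s') : P t s t s' := h.left.swap

def mk (A B C : Pt) (h : NC A B C) : Tri := ⟨A, B, C, (nc_iff _ _ _).2 h⟩

@[simp] lemma mk_vs (A B C : Pt) (h : NC A B C) : (mk A B C h).vertexSet = {A, B, C} := rfl

/-! ### The unlinked case -/

lemma range3 (A B C : Pt) : Set.range ![A, B, C] = {A, B, C} := by
  ext x
  simp only [Set.mem_range, Fin.exists_fin_succ, Set.mem_insert_iff, Set.mem_singleton_iff]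
  simp [eq_comm]

lemma span3_ne_top (A B C : Pt) : affineSpan ℝ ({A, B, C} : Set Pt) ≠ ⊤ := by
  intro h
  have h1 := finrank_vectorSpan_range_le ℝ ![A, B, C] (n := 2) (by simp)
  have h2 := range3 A B C
  rw [h2, ← direction_affineSpan, h, AffineSubspace.direction_top, finrank_top] at h1
  simp at h1

lemma span3_null (A B C : Pt) :
    MeasureTheory.volume (affineSpan ℝ ({A, B, C} : Set Pt) : Set Pt) = 0 :=
  MeasureTheory.Measure.addHaar_affineSubspace _ _ (span3_ne_top A B C)

lemma span2_null (A B : Pt) :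
    MeasureTheory.volume (affineSpan ℝ ({A, B} : Set Pt) : Set Pt) = 0 := by
  have := span3_null A A B
  rwa [Set.insert_eq_of_mem (by simp)] at this

lemma exists_avoid {U N : Set Pt} (hU : IsOpen U) (hne : U.Nonempty)
    (hN : MeasureTheory.volume N = 0) : ∃ x ∈ U, x ∉ N := by
  by_contra! h
  have h1 : MeasureTheory.volume U = 0 := MeasureTheory.measure_mono_null h hN
  exact (hU.measure_pos MeasureTheory.volume hne).ne' h1

lemma exists_tri {U : Set Pt} (hU : IsOpen U) (hne : U.Nonempty) :
    ∃ s : Tri, s.vertexSet ⊆ U := by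
  obtain ⟨A, hA⟩ := hne
  obtain ⟨B, hB, hB'⟩ := exists_avoid hU ⟨A, hA⟩ (span2_null A A)
  obtain ⟨C, hC, hC'⟩ := exists_avoid hU ⟨A, hA⟩ (span2_null A B)
  have hAB : A ≠ B := by rintro rfl; exact hB' (left_mem_affineSpan_pair ℝ _ _)
  refine ⟨mk A B C (nc_of_notMem hAB hC'), ?_⟩
  rw [mk_vs]
  rintro x (rfl | rfl | rfl) <;> assumption

lemma mv_conv {U O : Set Pt} (hc : Convex ℝ U) (hd : Disjoint U O) {s s' : Tri} {A B C C' : Pt}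
    (h : s.vertexSet = {A, B, C}) (h' : s'.vertexSet = {A, B, C'}) (hs : s.vertexSet ⊆ U)
    (hs' : s'.vertexSet ⊆ U) : Mv O s s' := by
  rw [h] at hs
  rw [h'] at hs'
  have hA : A ∈ U := hs (by simp)
  have hB : B ∈ U := hs (by simp)
  have hC : C ∈ U := hs (by simp)
  have hC' : C' ∈ U := hs' (by simp)
  refine ⟨A, B, C, C', h, h', fun x hx hO => ?_, fun x hx hO => ?_⟩
  · refine Set.disjoint_left.1 hd (convexHull_min ?_ hc hx) hO
    rintro x (rfl | rfl | rfl) <;> assumption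
  · refine Set.disjoint_left.1 hd (convexHull_min ?_ hc hx) hO
    rintro x (rfl | rfl | rfl) <;> assumption

lemma M_conv {U O : Set Pt} (hU : IsOpen U) (hc : Convex ℝ U) (hd : Disjoint U O) {s s' : Tri}
    (hs : s.vertexSet ⊆ U) (hs' : s'.vertexSet ⊆ U) : M O s s' := by
  have key : ∀ A B C A' B' C' : Pt, s.vertexSet = {A, B, C} → s'.vertexSet = {A', B', C'} →
      A ≠ A' → M O s s' := by
    intro A B C A' B' C' h h' hne
    have hA : A ∈ U := hs (by rw [h]; simp)
    have hB : B ∈ U := hs (by rw [h]; simp)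
    have hA' : A' ∈ U := hs' (by rw [h']; simp)
    have hB' : B' ∈ U := hs' (by rw [h']; simp)
    obtain ⟨X, hX, hXN⟩ := exists_avoid hU ⟨A, hA⟩
      (N := (affineSpan ℝ ({A, B} : Set Pt) : Set Pt) ∪ affineSpan ℝ ({A, A'} : Set Pt) ∪
        affineSpan ℝ ({A', B'} : Set Pt)) (by
        rw [MeasureTheory.measure_union_null_iff, MeasureTheory.measure_union_null_iff]
        exact ⟨⟨span2_null _ _, span2_null _ _⟩, span2_null _ _⟩)
    simp only [Set.mem_union, not_or] at hXN
    obtain ⟨⟨n1, n2⟩, n3⟩ := hXN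
    have m1 := nc_of_notMem (nc_of_vs h).ne n1
    have m2 := nc_of_notMem hne n2
    have m3 := nc_of_notMem (nc_of_vs h').ne n3
    have sub : ∀ P Q R : Pt, P ∈ U → Q ∈ U → R ∈ U → ({P, Q, R} : Set Pt) ⊆ U := by
      intro P Q R hP hQ hR
      rintro x (rfl | rfl | rfl) <;> assumption
    refine Relation.ReflTransGen.head (b := mk _ _ _ m1)
      (mv_conv hc hd h (mk_vs _ _ _ _) hs (sub _ _ _ hA hB hX)) ?_
    refine Relation.ReflTransGen.head (b := mk _ _ _ m2)
      (mv_conv hc hd (A := A) (B := X) (C := B) (C' := A') ?_ ?_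
        (sub _ _ _ hA hB hX) (sub _ _ _ hA hA' hX)) ?_
    · rw [mk_vs, Set.pair_comm]
    · rw [mk_vs, Set.pair_comm]
    refine Relation.ReflTransGen.head (b := mk _ _ _ m3)
      (mv_conv hc hd (A := A') (B := X) (C := A) (C' := B') ?_ ?_
        (sub _ _ _ hA hA' hX) (sub _ _ _ hA' hB' hX)) ?_
    · rw [mk_vs]; ext x; simp; tauto
    · rw [mk_vs, Set.pair_comm]
    exact Relation.ReflTransGen.single
      (mv_conv hc hd (mk_vs _ _ _ _) h' (sub _ _ _ hA' hB' hX) hs')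
  by_cases h : s.A = s'.A
  · refine key s.A s.B s.C s'.B s'.A s'.C rfl (Set.insert_comm _ _ _) ?_
    rw [h]; exact s'.nc.ne
  · exact key s.A s.B s.C s'.A s'.B s'.C rfl rfl h

lemma outl_sub_hull (s : Tri) : s.outline ⊆ s.hull := by
  intro x hx
  obtain ⟨a, b, c, h1, h2, h3, h4, h5, -⟩ := (outl (s := s) rfl).1 hx
  exact hull3.2 ⟨a, b, c, h1, h2, h3, h4, h5⟩

lemma outl_sub {s : Tri} {U : Set Pt} (hc : Convex ℝ U) (h : s.vertexSet ⊆ U) :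
    s.outline ⊆ U := (outl_sub_hull s).trans (convexHull_min h hc)

lemma hull_compact (s : Tri) : IsCompact s.hull :=
  (Set.toFinite ({s.A, s.B, s.C} : Set Pt)).isCompact_convexHull ℝ

lemma vs_sub_hull (s : Tri) : s.vertexSet ⊆ s.hull := subset_convexHull ℝ _

lemma exists_funct (f : Pt →L[ℝ] ℝ) (hf : f ≠ 0) :
    ∃ g : Pt →L[ℝ] ℝ, ∀ a b : ℝ, ∃ x, f x = a ∧ g x = b := by
  have : ∃ w, f w ≠ 0 := by
    by_contra! h
    exact hf (by ext x; simp [h])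
  obtain ⟨w, hw⟩ := this
  have : ∃ v : Pt, v ≠ 0 ∧ f v = 0 := by
    by_contra! h
    have hinj : Function.Injective (f : Pt →ₗ[ℝ] ℝ) := by
      rw [injective_iff_map_eq_zero]
      intro a ha
      by_contra hne
      exact h a hne ha
    have := LinearMap.finrank_le_finrank_of_injective hinj
    simp at this
  obtain ⟨v, hv, hfv⟩ := this
  have : ∃ i, v i ≠ 0 := by
    by_contra! h
    exact hv (funext h)
  obtain ⟨i, hi⟩ := this
  refine ⟨ContinuousLinearMap.proj i, fun a b => ?_⟩
  refine ⟨(a / f w) • w + ((b - (a / f w) * w i) / v i) • v, ?_, ?_⟩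
  · simp [hfv, hw]
  · simp; field_simp; ring

lemma sep_case {s t : Tri} (h : Disjoint s.hull t.hull) : P s t t s := by
  obtain ⟨f, u, v, h1, h2, h3⟩ := geometric_hahn_banach_compact_closed
    (convex_convexHull ℝ _) (hull_compact s) (convex_convexHull ℝ _) (hull_compact t).isClosed h
  have hf : f ≠ 0 := by
    rintro rfl
    have a := h1 s.A (vs_sub_hull s (by simp [Tri.vertexSet]))
    have b := h3 t.A (vs_sub_hull t (by simp [Tri.vertexSet]))
    simp at a b; linarith
  obtain ⟨g, hg⟩ := exists_funct f hf
  -- half spaces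
  have lo : ∀ (f : Pt →L[ℝ] ℝ) (c : ℝ), IsOpen {x | f x < c} := fun f c =>
    isOpen_lt f.continuous continuous_const
  have go : ∀ (f : Pt →L[ℝ] ℝ) (c : ℝ), IsOpen {x | c < f x} := fun f c =>
    isOpen_lt continuous_const f.continuous
  have lc : ∀ (f : Pt →L[ℝ] ℝ) (c : ℝ), Convex ℝ {x | f x < c} := fun f c =>
    convex_halfSpace_lt f.isLinear c
  have gc : ∀ (f : Pt →L[ℝ] ℝ) (c : ℝ), Convex ℝ {x | c < f x} := fun f c =>
    convex_halfSpace_gt f.isLinear c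
  have dj : ∀ (f : Pt →L[ℝ] ℝ) (c : ℝ), Disjoint {x | f x < c} {x | c < f x} := fun f c =>
    Set.disjoint_left.2 (fun x (hx : f x < c) (hx' : c < f x) => lt_asymm hx hx')
  have L : ∀ (f : Pt →L[ℝ] ℝ) (c : ℝ) (a a' b b' : Tri), a.vertexSet ⊆ {x | f x < c} →
      a'.vertexSet ⊆ {x | f x < c} → b.vertexSet ⊆ {x | c < f x} →
      b'.vertexSet ⊆ {x | c < f x} → P a b a' b' := by
    intro f c a a' b b' ha ha' hb hb'
    refine P.trans (s' := a') (t' := b) ?_ ?_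
    · exact (M_conv (lo f c) (lc f c) ((dj f c).mono_right (outl_sub (gc f c) hb)) ha ha').left
    · exact (M_conv (go f c) (gc f c)
        ((dj f c).symm.mono_right (outl_sub (lc f c) ha')) hb hb').right
  obtain ⟨mm, hmm⟩ := exists_tri ((lo f u).inter (lo g 0))
    (by obtain ⟨x, h, h'⟩ := hg (u - 1) (-1); exact ⟨x, by simp [h], by simp [h']⟩)
  obtain ⟨mp, hmp⟩ := exists_tri ((lo f u).inter (go g 0))
    (by obtain ⟨x, h, h'⟩ := hg (u - 1) 1; exact ⟨x, by simp [h], by simp [h']⟩)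
  obtain ⟨pm, hpm⟩ := exists_tri ((go f u).inter (lo g 0))
    (by obtain ⟨x, h, h'⟩ := hg (u + 1) (-1); exact ⟨x, by simp [h], by simp [h']⟩)
  obtain ⟨pp, hpp⟩ := exists_tri ((go f u).inter (go g 0))
    (by obtain ⟨x, h, h'⟩ := hg (u + 1) 1; exact ⟨x, by simp [h], by simp [h']⟩)
  rw [Set.subset_inter_iff] at hmm hmp hpm hpp
  have hs : s.vertexSet ⊆ {x | f x < u} := fun x hx => h1 x (vs_sub_hull s hx)
  have ht : t.vertexSet ⊆ {x | u < f x} := fun x hx => h2.trans (h3 x (vs_sub_hull t hx))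
  refine (L f u s mm t pp hs hmm.1 ht hpp.1).trans ?_
  refine (L g 0 mm pm pp mp hmm.2 hpm.2 hpp.2 hmp.2).trans ?_
  exact (L f u mp s pm t hmp.1 hs hpm.1 ht).swap

lemma unlinked {s t : Tri} (h : Disjoint s.hull t.outline) : P s t t s := by
  have tc : IsClosed t.outline := by
    simp only [Tri.outline, ← convexHull_pair]
    exact (((Set.toFinite _).isCompact_convexHull ℝ).union
      ((Set.toFinite _).isCompact_convexHull ℝ)).union
      ((Set.toFinite _).isCompact_convexHull ℝ) |>.isClosed
  obtain ⟨δ, hδ, hd⟩ := h.exists_thickenings (hull_compact s) tc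
  have hd' : Disjoint (Metric.thickening δ s.hull) t.outline :=
    hd.mono_right (Metric.self_subset_thickening hδ _)
  have hsub : s.vertexSet ⊆ Metric.thickening δ s.hull :=
    (vs_sub_hull s).trans (Metric.self_subset_thickening hδ _)
  have hop : IsOpen (Metric.thickening δ s.hull) := Metric.isOpen_thickening
  have hcv : Convex ℝ (Metric.thickening δ s.hull) := (convex_convexHull ℝ _).thickening δ
  obtain ⟨x, hx, hxN⟩ := exists_avoid hop ⟨s.A, hsub (by simp [Tri.vertexSet])⟩
    (span3_null t.A t.B t.C)
  have hxt : x ∉ t.hull := fun h => hxN (convexHull_subset_affineSpan _ h)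
  obtain ⟨ε, hε, hb⟩ := Metric.isOpen_iff.1 (hop.inter (hull_compact t).isClosed.isOpen_compl) x
    ⟨hx, hxt⟩
  rw [Set.subset_inter_iff] at hb
  obtain ⟨r, hr⟩ := exists_tri (Metric.isOpen_ball (x := x) (ε := ε)) ⟨x, by simpa using hε⟩
  have m1 : P s t r t := (M_conv hop hcv hd' hsub (hr.trans hb.1)).left
  have m2 : P r t t r := sep_case (by
    refine Set.disjoint_left.2 fun y hy hy' => ?_
    exact hb.2 (convexHull_min hr (convex_ball x ε) hy) hy')
  exact (m1.trans m2).trans m1.symm.swap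

/-! ### The standard Hopf configuration -/

abbrev R3 : Type := ℝ × ℝ × ℝ

def Fr (p e f g : Pt) (v : R3) : Pt := p + v.1 • e + v.2.1 • f + v.2.2 • g

def Ind3 (e f g : Pt) : Prop :=
  ∀ x y z : ℝ, x • e + y • f + z • g = 0 → x = 0 ∧ y = 0 ∧ z = 0

def NumNC (A B C : R3) : Prop := ∀ a b c : ℝ, a + b + c = 0 →
  a * A.1 + b * B.1 + c * C.1 = 0 → a * A.2.1 + b * B.2.1 + c * C.2.1 = 0 →
  a * A.2.2 + b * B.2.2 + c * C.2.2 = 0 → a = 0 ∧ b = 0 ∧ c = 0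

def NumSep (A B C X Y Z : R3) : Prop := ∀ a b c u v w : ℝ, 0 ≤ a → 0 ≤ b → 0 ≤ c →
  0 ≤ u → 0 ≤ v → 0 ≤ w → a + b + c = 1 → u + v + w = 1 → (u = 0 ∨ v = 0 ∨ w = 0) →
  a * A.1 + b * B.1 + c * C.1 = u * X.1 + v * Y.1 + w * Z.1 →
  a * A.2.1 + b * B.2.1 + c * C.2.1 = u * X.2.1 + v * Y.2.1 + w * Z.2.1 →
  a * A.2.2 + b * B.2.2 + c * C.2.2 = u * X.2.2 + v * Y.2.2 + w * Z.2.2 → False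

lemma nc_fr {p e f g : Pt} (hi : Ind3 e f g) {A B C : R3} (h : NumNC A B C) :
    NC (Fr p e f g A) (Fr p e f g B) (Fr p e f g C) := by
  intro a b c h0 h1
  obtain ⟨h2, h3, h4⟩ := hi (a * A.1 + b * B.1 + c * C.1) (a * A.2.1 + b * B.2.1 + c * C.2.1)
    (a * A.2.2 + b * B.2.2 + c * C.2.2) (by
      rw [← h1]
      have : (0 : Pt) = (a + b + c) • p := by rw [h0, zero_smul]
      rw [← zero_add (_ + _ + _ : Pt)]
      nth_rewrite 1 [this]
      simp only [Fr]
      module)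
  exact h a b c h0 h2 h3 h4

lemma sep_fr {p e f g : Pt} (hi : Ind3 e f g) {A B C X Y Z : R3} (h : NumSep A B C X Y Z)
    {t : Tri} (ht : t.vertexSet = {Fr p e f g X, Fr p e f g Y, Fr p e f g Z}) :
    ∀ x ∈ convexHull ℝ ({Fr p e f g A, Fr p e f g B, Fr p e f g C} : Set Pt),
      x ∉ t.outline := by
  intro x hx hx'
  obtain ⟨a, b, c, ha, hb, hc, hs, e1⟩ := hull3.1 hx
  obtain ⟨u, v, w, hu, hv, hw, hs', e2, h0⟩ := (outl ht).1 hx'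
  rw [e1] at e2
  have hc' : c = 1 - a - b := by linarith
  have hw' : w = 1 - u - v := by linarith
  obtain ⟨h2, h3, h4⟩ := hi
    (a * A.1 + b * B.1 + c * C.1 - (u * X.1 + v * Y.1 + w * Z.1))
    (a * A.2.1 + b * B.2.1 + c * C.2.1 - (u * X.2.1 + v * Y.2.1 + w * Z.2.1))
    (a * A.2.2 + b * B.2.2 + c * C.2.2 - (u * X.2.2 + v * Y.2.2 + w * Z.2.2)) (by
      have := sub_eq_zero.2 e2
      rw [← this, hc', hw']
      simp only [Fr]
      module)
  exact h a b c u v w ha hb hc hu hv hw hs hs' h0 (by linarith) (by linarith) (by linarith)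

lemma mv_fr {p e f g : Pt} (hi : Ind3 e f g) {A B C C' X Y Z : R3} {s t : Tri}
    (hs : s.vertexSet = {Fr p e f g A, Fr p e f g B, Fr p e f g C})
    (ht : t.vertexSet = {Fr p e f g X, Fr p e f g Y, Fr p e f g Z})
    (h0 : NumNC A B C')
    (h1 : NumSep A C C' X Y Z) (h2 : NumSep B C C' X Y Z) :
    ∃ s' : Tri, s'.vertexSet = {Fr p e f g A, Fr p e f g B, Fr p e f g C'} ∧ P s t s' t := by
  refine ⟨mk _ _ _ (nc_fr hi h0), rfl, M.left (Relation.ReflTransGen.single ?_)⟩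
  exact ⟨_, _, _, _, hs, rfl, sep_fr hi h1 ht, sep_fr hi h2 ht⟩

lemma rot3 (A B C : Pt) : ({A, B, C} : Set Pt) = {B, C, A} := by
  ext x; simp only [Set.mem_insert_iff, Set.mem_singleton_iff]; tauto

lemma relabel {s s' t : Tri} (h : s.vertexSet = s'.vertexSet)
    (hd : Disjoint s.outline t.outline) : P s t s' t := by
  refine M.left (Relation.ReflTransGen.single ⟨s.A, s.B, s.C, s.C, rfl, h.symm, ?_, ?_⟩)
  · intro x hx
    refine Set.disjoint_left.1 hd ?_
    rw [Set.pair_eq_singleton, convexHull_pair] at hx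
    right; rwa [segment_symm]
  · intro x hx
    refine Set.disjoint_left.1 hd ?_
    rw [Set.pair_eq_singleton, convexHull_pair] at hx
    left; right; exact hx

lemma outl_congr {s s' : Tri} (h : s.vertexSet = s'.vertexSet) : s.outline = s'.outline := by
  ext x; rw [outl_vs, outl_vs, h]

lemma std_swap {p e f g : Pt} (hi : Ind3 e f g) {s t : Tri}
    (hs : s.vertexSet = {Fr p e f g (1, 0, 0), Fr p e f g (-1, 1, 0), Fr p e f g (-1, -1, 0)})
    (ht : t.vertexSet = {Fr p e f g (0, 0, 0), Fr p e f g (2, 0, 1), Fr p e f g (2, 0, -1)})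
    (hd : Disjoint s.outline t.outline) :
    P s t t s := by
  obtain ⟨s1, hs1, m1⟩ := mv_fr hi (C' := (-1, -1, -1)) hs ht
    (by intro a b c; intros; simp at *; grind)
    (by intro a b c u v w; intros; simp at *; grind)
    (by intro a b c u v w; intros; simp at *; grind)
  obtain ⟨t1, ht1, m2⟩ := mv_fr hi (C' := (2, 1, -1)) ht hs1
    (by intro a b c; intros; simp at *; grind)
    (by intro a b c u v w; intros; simp at *; grind)
    (by intro a b c u v w; intros; simp at *; grind)
  rw [rot3] at ht1
  obtain ⟨t2, ht2, m3⟩ := mv_fr hi (C' := (-1, -1, 0)) ht1 hs1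
    (by intro a b c; intros; simp at *; grind)
    (by intro a b c u v w; intros; simp at *; grind)
    (by intro a b c u v w; intros; simp at *; grind)
  rw [rot3, rot3] at hs1
  obtain ⟨s2, hs2, m4⟩ := mv_fr hi (C' := (0, 0, 0)) hs1 ht2
    (by intro a b c; intros; simp at *; grind)
    (by intro a b c u v w; intros; simp at *; grind)
    (by intro a b c u v w; intros; simp at *; grind)
  rw [rot3] at ht2
  obtain ⟨t3, ht3, m5⟩ := mv_fr hi (C' := (-1, 1, 0)) ht2 hs2
    (by intro a b c; intros; simp at *; grind)
    (by intro a b c u v w; intros; simp at *; grind)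
    (by intro a b c u v w; intros; simp at *; grind)
  rw [rot3, rot3] at hs2
  obtain ⟨s3, hs3, m6⟩ := mv_fr hi (C' := (2, 0, 1)) hs2 ht3
    (by intro a b c; intros; simp at *; grind)
    (by intro a b c u v w; intros; simp at *; grind)
    (by intro a b c u v w; intros; simp at *; grind)
  rw [rot3] at ht3
  obtain ⟨t4, ht4, m7⟩ := mv_fr hi (C' := (1, 0, 0)) ht3 hs3
    (by intro a b c; intros; simp at *; grind)
    (by intro a b c u v w; intros; simp at *; grind)
    (by intro a b c u v w; intros; simp at *; grind)
  rw [rot3, rot3] at hs3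
  obtain ⟨s4, hs4, m8⟩ := mv_fr hi (C' := (2, 0, -1)) hs3 ht4
    (by intro a b c; intros; simp at *; grind)
    (by intro a b c u v w; intros; simp at *; grind)
    (by intro a b c u v w; intros; simp at *; grind)
  have e1 : s4.vertexSet = t.vertexSet := by
    rw [hs4, ht]; exact Set.insert_comm _ _ _
  have e2 : t4.vertexSet = s.vertexSet := by
    rw [hs, ht4, rot3, rot3, Set.pair_comm]
  have d1 : Disjoint t4.outline s4.outline := by rwa [outl_congr e1, outl_congr e2]
  have d2 : Disjoint s4.outline s.outline := by rw [outl_congr e1]; exact hd.symm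
  exact m1.trans <| m2.swap.trans <| m3.swap.trans <| m4.trans <| m5.swap.trans <| m6.trans <|
    m7.swap.trans <| m8.trans <| (relabel e2 d1).swap.trans (relabel e1 d2)

/-! ### Planar moves -/

def Ind2 (v w : Pt) : Prop := ∀ y z : ℝ, y • v + z • w = 0 → y = 0 ∧ z = 0

/-- obstacle condition: the only point of `O` in the plane `p + ⟨v,w⟩` with `f < m` is `p`. -/
def Obs (O : Set Pt) (p v w : Pt) (f : Pt →L[ℝ] ℝ) (m : ℝ) : Prop :=
  ∀ y z : ℝ, p + y • v + z • w ∈ O → f (y • v + z • w) < m → y • v + z • w = 0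

lemma Obs.change {O : Set Pt} {p v w v' w' : Pt} {f : Pt →L[ℝ] ℝ} {m : ℝ}
    (h : Obs O p v w f m) {a b c d : ℝ} (hv : v' = a • v + b • w) (hw : w' = c • v + d • w) :
    Obs O p v' w' f m := by
  intro y z h1 h2
  have e1 : y • v' + z • w' = (y * a + z * c) • v + (y * b + z * d) • w := by
    rw [hv, hw]; module
  rw [add_assoc, e1] at h1
  rw [e1] at h2 ⊢
  exact h _ _ (by rw [add_assoc]; exact h1) h2

lemma cone {p v w : Pt} (hi : Ind2 v w) {f : Pt →L[ℝ] ℝ} {m : ℝ} {O : Set Pt}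
    (hO : Obs O p v w f m) {s : Tri} {b c b' c' : ℝ} (hb : 0 < b) (hc : 0 < c) (hb' : 0 < b')
    (hc' : 0 < c') {u u' : Pt} (hu : u = -(b • v + c • w)) (hu' : u' = -(b' • v + c' • w))
    (hs : s.vertexSet = {p + v, p + w, p + u})
    (fv : f v < m) (fw : f w < m) (fu : f u < m) (fu' : f u' < m) :
    ∃ s' : Tri, s'.vertexSet = {p + v, p + w, p + u'} ∧ Mv O s s' := by
  have hnc : NC (p + v) (p + w) (p + u') := by
    intro x y z h0 h1
    have hx : x = -y - z := by linarith
    have := hi (x - z * b') (y - z * c') (by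
      rw [← h1, hu', hx]; module)
    obtain ⟨h2, h3⟩ := this
    have hz : z * (1 + b' + c') = 0 := by linear_combination h0 - h2 - h3
    have hz0 : z = 0 := by
      rcases mul_eq_zero.1 hz with h | h
      · exact h
      · exfalso; linarith
    subst hz0
    simp at h2 h3
    exact ⟨h2, h3, rfl⟩
  have lt_comb : ∀ x y z X Y Z : ℝ, 0 ≤ x → 0 ≤ y → 0 ≤ z → x + y + z = 1 → X < m → Y < m →
      Z < m → x * X + y * Y + z * Z < m := by
    intro x y z X Y Z hx hy hz h1 hX hY hZ
    have a1 : x * X ≤ x * max X (max Y Z) := mul_le_mul_of_nonneg_left (le_max_left _ _) hx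
    have a2 : y * Y ≤ y * max X (max Y Z) := mul_le_mul_of_nonneg_left (by simp) hy
    have a3 : z * Z ≤ z * max X (max Y Z) := mul_le_mul_of_nonneg_left (by simp) hz
    have a4 : max X (max Y Z) < m := max_lt hX (max_lt hY hZ)
    have a5 : x * max X (max Y Z) + y * max X (max Y Z) + z * max X (max Y Z)
        = max X (max Y Z) := by rw [← add_mul, ← add_mul, h1, one_mul]
    linarith
  refine ⟨mk _ _ _ hnc, rfl, p + v, p + w, p + u, p + u', hs, rfl, ?_, ?_⟩
  · intro x hx hxO
    obtain ⟨r1, r2, r3, p1, p2, p3, hr, rfl⟩ := hull3.1 hx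
    have hr1 : r1 = 1 - r2 - r3 := by linarith
    have e1 : (r1 - r2 * b - r3 * b') • v + (-r2 * c - r3 * c') • w
        = r1 • v + r2 • u + r3 • u' := by rw [hu, hu']; module
    have := hO (r1 - r2 * b - r3 * b') (-r2 * c - r3 * c') (by
      rw [add_assoc, e1]
      convert hxO using 1
      rw [hr1]; module) (by
      rw [e1]; simp only [map_add, map_smul, smul_eq_mul]
      exact lt_comb _ _ _ _ _ _ p1 p2 p3 hr fv fu fu')
    obtain ⟨h1, h2⟩ := hi _ _ this
    have q2 : r2 = 0 := by nlinarith [mul_nonneg p2 hc.le, mul_nonneg p3 hc'.le]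
    have q3 : r3 = 0 := by nlinarith [mul_nonneg p2 hc.le, mul_nonneg p3 hc'.le]
    subst q2 q3
    linarith
  · intro x hx hxO
    obtain ⟨r1, r2, r3, p1, p2, p3, hr, rfl⟩ := hull3.1 hx
    have hr1 : r1 = 1 - r2 - r3 := by linarith
    have e1 : (-r2 * b - r3 * b') • v + (r1 - r2 * c - r3 * c') • w
        = r1 • w + r2 • u + r3 • u' := by rw [hu, hu']; module
    have := hO (-r2 * b - r3 * b') (r1 - r2 * c - r3 * c') (by
      rw [add_assoc, e1]
      convert hxO using 1
      rw [hr1]; module) (by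
      rw [e1]; simp only [map_add, map_smul, smul_eq_mul]
      exact lt_comb _ _ _ _ _ _ p1 p2 p3 hr fw fu fu')
    obtain ⟨h1, h2⟩ := hi _ _ this
    have q2 : r2 = 0 := by nlinarith [mul_nonneg p2 hb.le, mul_nonneg p3 hb'.le]
    have q3 : r3 = 0 := by nlinarith [mul_nonneg p2 hb.le, mul_nonneg p3 hb'.le]
    subst q2 q3
    linarith

lemma exists_small (x : ℝ) {y : ℝ} (hy : 0 < y) : ∃ l : ℝ, 0 < l ∧ l * |x| < y := by
  refine ⟨y / (|x| + 1), by positivity, ?_⟩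
  rw [div_mul_eq_mul_div, div_lt_iff₀ (by positivity)]
  nlinarith [abs_nonneg x]

lemma planar_pos {p v w e : Pt} (hi : Ind2 v w) {f : Pt →L[ℝ] ℝ} {O : Set Pt}
    (hO : Obs O p v w f (2 * f e)) {s : Tri} {b c y z : ℝ} (hb : 0 < b) (hc : 0 < c) (hy : 0 < y)
    (hz : 0 < z) {u : Pt} (hu : u = -(b • v + c • w)) (he : e = -(y • v + z • w))
    (hs : s.vertexSet = {p + v, p + w, p + u})
    (fv : f v < 2 * f e) (fw : f w < 2 * f e) (fu : f u < 2 * f e) (fe : 0 < f e) :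
    ∃ (s' : Tri) (e2 : Pt) (k l : ℝ), e2 = k • v + l • w ∧
      s'.vertexSet = {p + e, p - e + e2, p - e - e2} ∧ M O s s' := by
  obtain ⟨s1, hs1, m1⟩ := cone hi hO hb hc hy hz hu he hs fv fw fu (by linarith)
  obtain ⟨L, hL, hL'⟩ := exists_small (f v) (y := 2 * f e) (by linarith)
  have hv1 := le_abs_self (f v)
  have hv2 := neg_abs_le (f v)
  -- move v to L v
  have hi2 : Ind2 w e := by
    intro x1 x2 hx
    obtain ⟨h1, h2⟩ := hi (-x2 * y) (x1 - x2 * z) (by rw [← hx, he]; module)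
    have : x2 = 0 := by
      rcases mul_eq_zero.1 h1 with h | h
      · linarith
      · linarith
    subst this
    exact ⟨by linarith, rfl⟩
  have hO2 : Obs O p w e f (2 * f e) :=
    hO.change (a := 0) (b := 1) (c := -y) (d := -z) (by simp) (by rw [he]; module)
  rw [rot3] at hs1
  obtain ⟨s2, hs2, m2⟩ := cone hi2 hO2 (b := z / y) (c := 1 / y) (b' := L * (z / y))
    (c' := L * (1 / y)) (by positivity) (by positivity) (by positivity) (by positivity)
    (u := v) (u' := L • v)
    (by rw [he, ← sub_eq_zero]; match_scalars <;> field_simp <;> ring)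
    (by rw [he, ← sub_eq_zero]; match_scalars <;> field_simp <;> ring)
    hs1 fw (by linarith) fv (by rw [map_smul, smul_eq_mul]; nlinarith)
  rw [rot3] at hs2
  have hi3 : Ind2 e (L • v) := by
    intro x1 x2 hx
    obtain ⟨h1, h2⟩ := hi (-x1 * y + x2 * L) (- x1 * z) (by rw [← hx, he]; module)
    have : x1 = 0 := by
      rcases mul_eq_zero.1 h2 with h | h
      · linarith
      · linarith
    subst this
    refine ⟨rfl, ?_⟩
    rcases mul_eq_zero.1 (show x2 * L = 0 by linarith) with h | h
    · exact h
    · linarith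
  have hO3 : Obs O p e (L • v) f (2 * f e) :=
    hO.change (a := -y) (b := -z) (c := L) (d := 0) (by rw [he]; module) (by simp)
  obtain ⟨s3, hs3, m3⟩ := cone hi3 hO3 (b := 1 / z) (c := y / (z * L)) (b' := 2)
    (c' := 1) (by positivity) (by positivity) (by positivity) (by positivity)
    (u := w) (u' := -((2 : ℝ) • e + (1 : ℝ) • (L • v)))
    (by rw [he, ← sub_eq_zero]; match_scalars <;> field_simp <;> ring)
    rfl
    hs2 (by linarith) (by rw [map_smul, smul_eq_mul]; nlinarith) fw (by
      simp only [map_add, map_neg, map_smul, smul_eq_mul]; nlinarith)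
  refine ⟨s3, L • v + e, L - y, -z, by rw [he]; module, ?_,
    ((Relation.ReflTransGen.single m1).tail m2).tail m3⟩
  rw [hs3]
  have a1 : p + L • v = p - e + (L • v + e) := by module
  have a2 : p + -((2 : ℝ) • e + (1 : ℝ) • (L • v)) = p - e - (L • v + e) := by module
  rw [a1, a2]

lemma planar_nonneg {p v w e : Pt} (hi : Ind2 v w) {f : Pt →L[ℝ] ℝ} {O : Set Pt}
    (hO : Obs O p v w f (2 * f e)) {s : Tri} {b c y z : ℝ} (hb : 0 < b) (hc : 0 < c) (hy : 0 < y)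
    (hz : 0 ≤ z) {u : Pt} (hu : u = -(b • v + c • w)) (he : e = -(y • v + z • w))
    (hs : s.vertexSet = {p + v, p + w, p + u})
    (fv : f v < 2 * f e) (fw : f w < 2 * f e) (fu : f u < 2 * f e) (fe : 0 < f e) :
    ∃ (s' : Tri) (e2 : Pt) (k l : ℝ), e2 = k • v + l • w ∧
      s'.vertexSet = {p + e, p - e + e2, p - e - e2} ∧ M O s s' := by
  rcases hz.eq_or_lt with h | hz
  swap
  · exact planar_pos hi hO hb hc hy hz hu he hs fv fw fu fe
  subst h
  obtain ⟨L, hL, hL'⟩ := exists_small (f (v - w)) (y := 2 * f e) (by linarith)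
  have hi2 : Ind2 w u := by
    intro x1 x2 hx
    obtain ⟨h1, h2⟩ := hi (-x2 * b) (x1 - x2 * c) (by rw [← hx, hu]; module)
    have : x2 = 0 := by
      rcases mul_eq_zero.1 h1 with h | h
      · linarith
      · linarith
    subst this
    exact ⟨by linarith, rfl⟩
  have hO2 : Obs O p w u f (2 * f e) :=
    hO.change (a := 0) (b := 1) (c := -b) (d := -c) (by simp) (by rw [hu]; module)
  rw [rot3] at hs
  have fv' : f (L • (v - w)) < 2 * f e := by
    rw [map_smul, smul_eq_mul]; nlinarith [le_abs_self (f (v - w))]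
  obtain ⟨s2, hs2, m2⟩ := cone hi2 hO2 (b := c / b) (c := 1 / b) (b' := L * (c / b + 1))
    (c' := L * (1 / b)) (by positivity) (by positivity) (by positivity) (by positivity)
    (u := v) (u' := L • (v - w))
    (by rw [hu, ← sub_eq_zero]; match_scalars <;> field_simp <;> ring)
    (by rw [hu, ← sub_eq_zero]; match_scalars <;> field_simp <;> ring)
    hs fw fu fv fv'
  rw [rot3, rot3] at hs2
  have hi3 : Ind2 (L • (v - w)) w := by
    intro x1 x2 hx
    obtain ⟨h1, h2⟩ := hi (x1 * L) (x2 - x1 * L) (by rw [← hx]; module)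
    have : x1 = 0 := by
      rcases mul_eq_zero.1 h1 with h | h
      · linarith
      · linarith
    subst this
    exact ⟨rfl, by linarith⟩
  have hO3 : Obs O p (L • (v - w)) w f (2 * f e) :=
    hO.change (a := L) (b := -L) (c := 0) (d := 1) (by module) (by simp)
  obtain ⟨s', e2, k, l, he2, hs', m3⟩ := planar_pos hi3 hO3 (b := b / L) (c := b + c)
    (y := y / L) (z := y)
    (by positivity) (by positivity) (by positivity) (by positivity) (u := u)
    (by rw [hu, ← sub_eq_zero]; match_scalars <;> field_simp <;> ring)
    (by rw [he, ← sub_eq_zero]; match_scalars <;> field_simp <;> ring)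
    hs2 fv' fw fu fe
  exact ⟨s', e2, k * L, l - k * L, by rw [he2]; module, hs', m3.head m2⟩

/-! ### The linked case -/

def Pl (s : Tri) : Set Pt :=
  {x | ∃ a b c : ℝ, a + b + c = 1 ∧ x = a • s.A + b • s.B + c • s.C}

lemma Pl_comb {s : Tri} {x y z : Pt} (hx : x ∈ Pl s) (hy : y ∈ Pl s) (hz : z ∈ Pl s)
    {a b c : ℝ} (h : a + b + c = 1) : a • x + b • y + c • z ∈ Pl s := by
  obtain ⟨x1, x2, x3, h1, rfl⟩ := hx
  obtain ⟨y1, y2, y3, h2, rfl⟩ := hy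
  obtain ⟨z1, z2, z3, h3, rfl⟩ := hz
  refine ⟨a * x1 + b * y1 + c * z1, a * x2 + b * y2 + c * z2, a * x3 + b * y3 + c * z3, ?_, ?_⟩
  · linear_combination a * h1 + b * h2 + c * h3 + h
  · module

lemma hull_sub_Pl (s : Tri) : s.hull ⊆ Pl s := by
  intro x hx
  obtain ⟨a, b, c, -, -, -, h, h'⟩ := hull3.1 hx
  exact ⟨a, b, c, h, h'⟩

lemma coord_unique (s : Tri) {a b c a' b' c' : ℝ} (h : a + b + c = 1) (h' : a' + b' + c' = 1)
    (he : a • s.A + b • s.B + c • s.C = a' • s.A + b' • s.B + c' • s.C) :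
    a = a' ∧ b = b' ∧ c = c' := by
  obtain ⟨h1, h2, h3⟩ := s.nc (a - a') (b - b') (c - c') (by linarith) (by
    rw [← sub_eq_zero.2 he]; module)
  exact ⟨by linarith, by linarith, by linarith⟩

lemma Pl_eq (s : Tri) : Pl s = (affineSpan ℝ (Set.range ![s.A, s.B, s.C]) : Set Pt) := by
  ext x
  constructor
  · rintro ⟨a, b, c, h, rfl⟩
    have hw : ∑ i, (![a, b, c] : Fin 3 → ℝ) i = 1 := by simpa [Fin.sum_univ_three] using h
    have := affineCombination_mem_affineSpan hw ![s.A, s.B, s.C]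
    rw [Finset.affineCombination_eq_linear_combination _ _ _ hw] at this
    simpa [Fin.sum_univ_three] using this
  · intro hx
    obtain ⟨w, hw, h⟩ := eq_affineCombination_of_mem_affineSpan_of_fintype hx
    rw [Finset.affineCombination_eq_linear_combination _ _ _ hw] at h
    refine ⟨w 0, w 1, w 2, by simpa [Fin.sum_univ_three] using hw, by
      simpa [Fin.sum_univ_three] using h⟩

lemma coplane {s t : Tri} {x y z : Pt} (h : NC x y z) (hs : ∀ w ∈ ({x, y, z} : Set Pt), w ∈ Pl s)
    (ht : ∀ w ∈ ({x, y, z} : Set Pt), w ∈ Pl t) : Pl t ⊆ Pl s := by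
  have key : ∀ t : Tri, (∀ w ∈ ({x, y, z} : Set Pt), w ∈ Pl t) →
      Pl t = (affineSpan ℝ (Set.range ![x, y, z]) : Set Pt) := by
    intro t ht
    rw [Pl_eq]
    congr 1
    symm
    apply ((nc_iff x y z).2 h).affineSpan_eq_of_le_of_card_eq_finrank_add_one
    · rw [affineSpan_le, range3]
      intro w hw
      rw [← Pl_eq]
      exact ht w hw
    · rw [direction_affineSpan, t.indep.finrank_vectorSpan (n := 2) (by simp)]
      simp
  rw [key s hs, key t ht]

lemma exit_lem {x0 x1 x2 d0 d1 d2 : ℝ} (h0 : 0 < x0) (h1 : 0 < x1) (h2 : 0 < x2)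
    (hd : d0 + d1 + d2 = 0) (hne : ¬ (d0 = 0 ∧ d1 = 0 ∧ d2 = 0)) :
    ∃ t : ℝ, 0 < t ∧ 0 ≤ x0 + t * d0 ∧ 0 ≤ x1 + t * d1 ∧ 0 ≤ x2 + t * d2 ∧
      (x0 + t * d0 = 0 ∨ x1 + t * d1 = 0 ∨ x2 + t * d2 = 0) := by
  set m := max (-d0 / x0) (max (-d1 / x1) (-d2 / x2)) with hm
  have a0 : -d0 / x0 ≤ m := le_max_left _ _
  have a1 : -d1 / x1 ≤ m := by simp [hm]
  have a2 : -d2 / x2 ≤ m := by simp [hm]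
  rw [div_le_iff₀ h0] at a0
  rw [div_le_iff₀ h1] at a1
  rw [div_le_iff₀ h2] at a2
  have hpos : 0 < m := by
    by_contra hle
    push Not at hle
    have b0 : 0 ≤ d0 := by nlinarith
    have b1 : 0 ≤ d1 := by nlinarith
    have b2 : 0 ≤ d2 := by nlinarith
    exact hne ⟨by linarith, by linarith, by linarith⟩
  have e : ∀ x d : ℝ, x + 1 / m * d = (m * x + d) / m := by intro x d; field_simp
  refine ⟨1 / m, by positivity, ?_, ?_, ?_, ?_⟩
  · rw [e]; exact div_nonneg (by linarith) hpos.le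
  · rw [e]; exact div_nonneg (by linarith) hpos.le
  · rw [e]; exact div_nonneg (by linarith) hpos.le
  · rw [e, e, e]
    have : m = -d0 / x0 ∨ m = -d1 / x1 ∨ m = -d2 / x2 := by
      rcases max_choice (-d0 / x0) (max (-d1 / x1) (-d2 / x2)) with h | h
      · left; rw [hm, h]
      · rcases max_choice (-d1 / x1) (-d2 / x2) with h' | h'
        · right; left; rw [hm, h, h']
        · right; right; rw [hm, h, h']
    rcases this with h | h | h
    · left; rw [div_eq_zero_iff]; left; rw [eq_div_iff h0.ne'] at h; linarith
    · right; left; rw [div_eq_zero_iff]; left; rw [eq_div_iff h1.ne'] at h; linarith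
    · right; right; rw [div_eq_zero_iff]; left; rw [eq_div_iff h2.ne'] at h; linarith

lemma planar_key {s : Tri} {A B C p e : Pt} {O : Set Pt} (f : Pt →L[ℝ] ℝ)
    (hs : s.vertexSet = {A, B, C}) {α β γ m n t : ℝ} (hα : 0 < α) (hβ : 0 < β) (hγ : 0 < γ)
    (h1 : α + β + γ = 1) (hp : p = α • A + β • B + γ • C) (ht : 0 < t) (hm : 0 < m) (hn : 0 ≤ n)
    (hmn : m + n = 1) (he : p - t • e = m • B + n • C)
    (fA : f A < f p + 2 * f e) (fB : f B < f p + 2 * f e) (fC : f C < f p + 2 * f e)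
    (fe : 0 < f e)
    (hO : ∀ y z : ℝ, p + y • (B - p) + z • (C - p) ∈ O →
      f (y • (B - p) + z • (C - p)) < 2 * f e → y • (B - p) + z • (C - p) = 0) :
    ∃ (s' : Tri) (e2 : Pt) (k l : ℝ), e2 = k • (B - p) + l • (C - p) ∧
      s'.vertexSet = {p + e, p - e + e2, p - e - e2} ∧ M O s s' := by
  have hα' : α = 1 - β - γ := by linarith
  have hi : Ind2 (B - p) (C - p) := by
    intro y z hyz
    obtain ⟨q1, q2, q3⟩ := nc_of_vs hs (-(y + z) * α) (y - (y + z) * β) (z - (y + z) * γ)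
      (by rw [hα']; ring) (by rw [← hyz, hp]; module)
    have : y + z = 0 := by
      rcases mul_eq_zero.1 q1 with h | h <;> linarith
    rw [this] at q2 q3
    exact ⟨by linarith, by linarith⟩
  refine planar_nonneg hi hO (b := β / α) (c := γ / α) (y := m / t) (z := n / t) (by positivity)
    (by positivity) (by positivity) (by positivity) (u := A - p) ?_ ?_ ?_ ?_ ?_ ?_ fe
  · have : α • (A - p) = α • -((β / α) • (B - p) + (γ / α) • (C - p)) := by
      have e1 : α • -((β / α) • (B - p) + (γ / α) • (C - p))
          = -(β • (B - p) + γ • (C - p)) := by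
        match_scalars <;> field_simp
      rw [e1, ← sub_eq_zero]
      have e2 : α • (A - p) - -(β • (B - p) + γ • (C - p))
        = (α • A + β • B + γ • C) - (α + β + γ) • p := by module
      rw [e2, h1, ← hp]; simp
    exact smul_right_injective Pt hα.ne' this
  · have : t • e = t • -((m / t) • (B - p) + (n / t) • (C - p)) := by
      have e1 : t • -((m / t) • (B - p) + (n / t) • (C - p))
          = -(m • (B - p) + n • (C - p)) := by
        match_scalars <;> field_simp
      have e2 : -(m • (B - p) + n • (C - p)) = (m + n) • p - (m • B + n • C) := by module
      rw [e1, e2, hmn, ← he]; module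
    exact smul_right_injective Pt ht.ne' this
  · rw [hs, rot3]; simp
  · rw [map_sub]; linarith
  · rw [map_sub]; linarith
  · rw [map_sub]; linarith

lemma planar {s : Tri} {p e : Pt} {O : Set Pt} {α β γ : ℝ} (hα : 0 < α) (hβ : 0 < β) (hγ : 0 < γ)
    (h1 : α + β + γ = 1) (hp : p = α • s.A + β • s.B + γ • s.C) (hq : p + (2 : ℝ) • e ∉ s.hull)
    (he : p + e ∈ Pl s) (hO : ∀ x ∈ O, x ∈ Pl s → x = p ∨ x = p + (2 : ℝ) • e) :
    ∃ (s' : Tri) (e2 : Pt), p + e2 ∈ Pl s ∧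
      s'.vertexSet = {p + e, p - e + e2, p - e - e2} ∧ M O s s' := by
  obtain ⟨f, u, hu, hu'⟩ := geometric_hahn_banach_closed_point (convex_convexHull ℝ _)
    (hull_compact s).isClosed hq
  have hps : p ∈ s.hull := hull3.2 ⟨α, β, γ, hα.le, hβ.le, hγ.le, h1, hp⟩
  have hpP : p ∈ Pl s := hull_sub_Pl s hps
  have hA := hu s.A (vs_sub_hull s (by simp [Tri.vertexSet]))
  have hB := hu s.B (vs_sub_hull s (by simp [Tri.vertexSet]))
  have hC := hu s.C (vs_sub_hull s (by simp [Tri.vertexSet]))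
  have hpu := hu p hps
  rw [map_add, map_smul, smul_eq_mul] at hu'
  have PA : s.A ∈ Pl s := hull_sub_Pl s (vs_sub_hull s (by simp [Tri.vertexSet]))
  have PB : s.B ∈ Pl s := hull_sub_Pl s (vs_sub_hull s (by simp [Tri.vertexSet]))
  have PC : s.C ∈ Pl s := hull_sub_Pl s (vs_sub_hull s (by simp [Tri.vertexSet]))
  have fin : ∀ B C : Pt, B ∈ Pl s → C ∈ Pl s → ∀ y z : ℝ,
      p + (y • (B - p) + z • (C - p)) ∈ Pl s := by
    intro B C hB hC y z
    have := Pl_comb hpP hB hC (a := 1 - y - z) (b := y) (c := z) (by ring)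
    convert this using 1; module
  have obs : ∀ B C : Pt, B ∈ Pl s → C ∈ Pl s → ∀ y z : ℝ, p + y • (B - p) + z • (C - p) ∈ O →
      f (y • (B - p) + z • (C - p)) < 2 * f e → y • (B - p) + z • (C - p) = 0 := by
    intro B C hB hC y z h h'
    rw [add_assoc] at h
    rcases hO _ h (fin B C hB hC y z) with h2 | h2
    · simpa using h2
    · rw [add_right_inj] at h2
      rw [h2, map_smul, smul_eq_mul] at h'
      exact absurd h' (lt_irrefl _)
  obtain ⟨a, b, c, habc, hpe⟩ := he
  have hne : ¬ (α - a = 0 ∧ β - b = 0 ∧ γ - c = 0) := by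
    rintro ⟨i1, i2, i3⟩
    have : e = 0 := by
      have : p + e = p := by
        rw [hpe, hp, sub_eq_zero.1 i1, sub_eq_zero.1 i2, sub_eq_zero.1 i3]
      simpa using this
    rw [this] at hu'; simp at hu'; linarith
  obtain ⟨t, ht, t0, t1, t2, h0⟩ := exit_lem hα hβ hγ
    (d0 := α - a) (d1 := β - b) (d2 := γ - c) (by linarith) hne
  set X := α + t * (α - a) with hX
  set Y := β + t * (β - b) with hY
  set Z := γ + t * (γ - c) with hZ
  have hsum : X + Y + Z = 1 := by
    rw [hX, hY, hZ]; linear_combination (1 + t) * h1 - t * habc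
  have hte : p - t • e = X • s.A + Y • s.B + Z • s.C := by
    have : e = p + e - p := by abel
    rw [this, hpe, hp, hX, hY, hZ]; module
  have K : ∀ (A B C : Pt) (α β γ m n : ℝ), s.vertexSet = {A, B, C} → 0 < α → 0 < β → 0 < γ →
      α + β + γ = 1 → p = α • A + β • B + γ • C → 0 ≤ m → 0 ≤ n → m + n = 1 →
      p - t • e = m • B + n • C → A ∈ s.vertexSet → B ∈ s.vertexSet → C ∈ s.vertexSet →
      ∃ (s' : Tri) (e2 : Pt), p + e2 ∈ Pl s ∧
        s'.vertexSet = {p + e, p - e + e2, p - e - e2} ∧ M O s s' := by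
    intro A B C α β γ m n hs hα hβ hγ h1 hp hm hn hmn h hA hB hC
    have PB := hull_sub_Pl s (vs_sub_hull s hB)
    have PC := hull_sub_Pl s (vs_sub_hull s hC)
    have fA := hu A (vs_sub_hull s hA)
    have fB := hu B (vs_sub_hull s hB)
    have fC := hu C (vs_sub_hull s hC)
    rcases hm.eq_or_lt with h0 | h0
    · obtain ⟨s', e2, k, l, r1, r2, r3⟩ := planar_key f (A := A) (B := C) (C := B)
        (p := p) (e := e) (O := O) (s := s) (by rw [hs, Set.pair_comm]) hα hγ hβ
        (by linarith) (by rw [hp]; abel) ht (m := n) (n := m) (by linarith) hm (by linarith)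
        (by rw [h]; abel) (by linarith) (by linarith) (by linarith) (by linarith)
        (obs _ _ PC PB)
      exact ⟨s', e2, by rw [r1]; exact fin _ _ PC PB _ _, r2, r3⟩
    · obtain ⟨s', e2, k, l, r1, r2, r3⟩ := planar_key f (A := A) (B := B) (C := C)
        (p := p) (e := e) (O := O) (s := s) hs hα hβ hγ
        h1 hp ht (m := m) (n := n) h0 hn hmn
        h (by linarith) (by linarith) (by linarith) (by linarith)
        (obs _ _ PB PC)
      exact ⟨s', e2, by rw [r1]; exact fin _ _ PB PC _ _, r2, r3⟩
  rcases h0 with h0 | h0 | h0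
  · refine K s.A s.B s.C α β γ Y Z rfl hα hβ hγ h1 hp t1 t2 (by linarith) ?_ ?_ ?_ ?_
    · rw [hte, h0]; simp
    all_goals simp [Tri.vertexSet]
  · refine K s.B s.C s.A β γ α Z X (rot3 _ _ _) hβ hγ hα (by linarith) (by rw [hp]; abel) t2 t0
      (by linarith) ?_ ?_ ?_ ?_
    · rw [hte, h0]; simp [add_comm]
    all_goals simp [Tri.vertexSet]
  · refine K s.C s.A s.B γ α β X Y ((rot3 _ _ _).symm) hγ hα hβ (by linarith)
      (by rw [hp]; abel) t0 t1 (by linarith) ?_ ?_ ?_ ?_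
    · rw [hte, h0]; simp
    all_goals simp [Tri.vertexSet]

lemma stay {s : Tri} {x y : Pt} (hx : x ∈ s.hull) (hy : y ∈ Pl s)
    (hd : ∀ w ∈ segment ℝ x y, w ∉ s.outline) : y ∈ s.hull := by
  obtain ⟨a, b, c, ha, hb, hc, h1, hxe⟩ := hull3.1 hx
  obtain ⟨a', b', c', h1', hye⟩ := hy
  have hxo := hd x (left_mem_segment ℝ x y)
  rw [outl (s := s) rfl] at hxo
  have ha0 : a ≠ 0 := fun h => hxo ⟨a, b, c, ha, hb, hc, h1, hxe, Or.inl h⟩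
  have hb0 : b ≠ 0 := fun h => hxo ⟨a, b, c, ha, hb, hc, h1, hxe, Or.inr (Or.inl h)⟩
  have hc0 : c ≠ 0 := fun h => hxo ⟨a, b, c, ha, hb, hc, h1, hxe, Or.inr (Or.inr h)⟩
  by_cases hne : a' - a = 0 ∧ b' - b = 0 ∧ c' - c = 0
  · obtain ⟨i1, i2, i3⟩ := hne
    exact hull3.2 ⟨a', b', c', by linarith, by linarith, by linarith, h1', hye⟩
  obtain ⟨t, ht, t0, t1, t2, h0⟩ := exit_lem (lt_of_le_of_ne ha ha0.symm)
    (lt_of_le_of_ne hb hb0.symm) (lt_of_le_of_ne hc hc0.symm)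
    (d0 := a' - a) (d1 := b' - b) (d2 := c' - c) (by linarith) hne
  by_cases hle : t ≤ 1
  · exfalso
    refine hd ((1 - t) • x + t • y) ⟨1 - t, t, by linarith, ht.le, by ring, rfl⟩ ?_
    rw [outl (s := s) rfl]
    refine ⟨_, _, _, t0, t1, t2, ?_, ?_, h0⟩
    · linear_combination (1 - t) * h1 + t * h1'
    · rw [hxe, hye]; module
  · push Not at hle
    have key : ∀ u u' : ℝ, 0 ≤ u → 0 ≤ u + t * (u' - u) → 0 ≤ u' := by
      intro u u' hu h
      by_contra hn
      push Not at hn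
      nlinarith
    exact hull3.2 ⟨a', b', c', key _ _ ha t0, key _ _ hb t1, key _ _ hc t2, h1', hye⟩

lemma edges (t : Tri) : segment ℝ t.A t.B ⊆ t.outline ∧ segment ℝ t.B t.C ⊆ t.outline ∧
    segment ℝ t.C t.A ⊆ t.outline := by
  refine ⟨fun x h => Or.inl (Or.inl h), fun x h => Or.inl (Or.inr h), fun x h => Or.inr h⟩

lemma all_in {s t : Tri} (hd : Disjoint s.outline t.outline) {p : Pt} (hp : p ∈ s.hull)
    (hp' : p ∈ t.outline) (hP : Pl t ⊆ Pl s) : t.hull ⊆ s.hull := by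
  have PA : t.A ∈ Pl s := hP (hull_sub_Pl t (vs_sub_hull t (by simp [Tri.vertexSet])))
  have PB : t.B ∈ Pl s := hP (hull_sub_Pl t (vs_sub_hull t (by simp [Tri.vertexSet])))
  have PC : t.C ∈ Pl s := hP (hull_sub_Pl t (vs_sub_hull t (by simp [Tri.vertexSet])))
  have K : ∀ U V x : Pt, segment ℝ U V ⊆ t.outline → U ∈ Pl s → V ∈ Pl s → x ∈ segment ℝ U V →
      x ∈ s.hull → U ∈ s.hull ∧ V ∈ s.hull := by
    intro U V x h hU hV hx hxs
    constructor
    · refine stay hxs hU (fun w hw => ?_)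
      exact Set.disjoint_right.1 hd (h ((convex_segment U V).segment_subset hx
        (left_mem_segment ℝ U V) hw))
    · refine stay hxs hV (fun w hw => ?_)
      exact Set.disjoint_right.1 hd (h ((convex_segment U V).segment_subset hx
        (right_mem_segment ℝ U V) hw))
  obtain ⟨e1, e2, e3⟩ := edges t
  have : t.A ∈ s.hull ∧ t.B ∈ s.hull ∧ t.C ∈ s.hull := by
    rcases hp' with (h | h) | h
    · obtain ⟨i1, i2⟩ := K _ _ _ e1 PA PB h hp
      obtain ⟨i3, i4⟩ := K _ _ _ e2 PB PC (left_mem_segment ℝ _ _) i2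
      exact ⟨i1, i2, i4⟩
    · obtain ⟨i1, i2⟩ := K _ _ _ e2 PB PC h hp
      obtain ⟨i3, i4⟩ := K _ _ _ e3 PC PA (left_mem_segment ℝ _ _) i2
      exact ⟨i4, i1, i2⟩
    · obtain ⟨i1, i2⟩ := K _ _ _ e3 PC PA h hp
      obtain ⟨i3, i4⟩ := K _ _ _ e1 PA PB (left_mem_segment ℝ _ _) i2
      exact ⟨i2, i4, i1⟩
  refine convexHull_min ?_ (convex_convexHull ℝ _)
  rintro x (rfl | rfl | rfl)
  exacts [this.1, this.2.1, this.2.2]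

lemma line_pos {π σ k m : ℝ} (hπ : 0 ≤ π) (hσ : 0 < σ) (hk : 0 < k)
    (hκ : 0 ≤ σ + k * (σ - π)) (h0 : 0 < m) (h1 : m < 1 + k) : 0 < π + m * (σ - π) := by
  have e : (1 + k) * (π + m * (σ - π)) = (1 + k - m) * π + m * (σ + k * (σ - π)) := by ring
  have : 0 < (1 + k) * (π + m * (σ - π)) := by
    rw [e]
    rcases hπ.eq_or_lt with h | h
    · rw [← h] at hκ ⊢
      have : 0 < σ + k * (σ - 0) := by nlinarith
      have := mul_pos h0 this
      linarith
    · have := mul_pos (sub_pos.2 h1) h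
      have := mul_nonneg h0.le hκ
      linarith
  exact (pos_iff_pos_of_mul_pos this).1 (by linarith)

lemma line_lo {π σ m : ℝ} (hπ : π = 0) (hσ : 0 < σ) (h : 0 ≤ π + m * (σ - π)) : 0 ≤ m := by
  rw [hπ] at h
  by_contra hn
  push Not at hn
  nlinarith

lemma line_hi {π σ k m : ℝ} (hσ : 0 < σ) (hk : 0 < k)
    (hκ : σ + k * (σ - π) = 0) (h : 0 ≤ π + m * (σ - π)) : m ≤ 1 + k := by
  have hd : σ - π < 0 := by
    by_contra hn
    push Not at hn
    nlinarith
  by_contra hn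
  push Not at hn
  nlinarith

lemma linked {s t : Tri} (hd : Disjoint s.outline t.outline) {p r : Pt} (hp : p ∈ s.hull)
    (hp' : p ∈ t.outline) (hr : r ∈ t.hull) (hr' : r ∈ s.outline) : P s t t s := by
  obtain ⟨α, β, γ, hα, hβ, hγ, hα1, hpα⟩ := hull3.1 hp
  obtain ⟨σ0, σ1, σ2, hσ0, hσ1, hσ2, hσs, hrσ⟩ := hull3.1 hr
  obtain ⟨π0, π1, π2, hπ0, hπ1, hπ2, hπs, hpπ, hπz⟩ := (outl (s := t) rfl).1 hp'
  obtain ⟨ρ0, ρ1, ρ2, hρ0, hρ1, hρ2, hρs, hrρ, hρz⟩ := (outl (s := s) rfl).1 hr'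
  have hpo : p ∉ s.outline := Set.disjoint_right.1 hd hp'
  have hro : r ∉ t.outline := Set.disjoint_left.1 hd hr'
  have hrp : p ≠ r := fun h => hpo (h ▸ hr')
  rw [outl (s := s) rfl] at hpo
  rw [outl (s := t) rfl] at hro
  have hα : 0 < α := lt_of_le_of_ne hα
    (fun h => hpo ⟨α, β, γ, hα, hβ, hγ, hα1, hpα, Or.inl h.symm⟩)
  have hβ : 0 < β := lt_of_le_of_ne hβ
    (fun h => hpo ⟨α, β, γ, hα.le, hβ, hγ, hα1, hpα, Or.inr (Or.inl h.symm)⟩)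
  have hγ : 0 < γ := lt_of_le_of_ne hγ
    (fun h => hpo ⟨α, β, γ, hα.le, hβ.le, hγ, hα1, hpα, Or.inr (Or.inr h.symm)⟩)
  have hσ0 : 0 < σ0 := lt_of_le_of_ne hσ0
    (fun h => hro ⟨σ0, σ1, σ2, hσ0, hσ1, hσ2, hσs, hrσ, Or.inl h.symm⟩)
  have hσ1 : 0 < σ1 := lt_of_le_of_ne hσ1
    (fun h => hro ⟨σ0, σ1, σ2, hσ0.le, hσ1, hσ2, hσs, hrσ, Or.inr (Or.inl h.symm)⟩)
  have hσ2 : 0 < σ2 := lt_of_le_of_ne hσ2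
    (fun h => hro ⟨σ0, σ1, σ2, hσ0.le, hσ1.le, hσ2, hσs, hrσ, Or.inr (Or.inr h.symm)⟩)
  have hne : ¬ (σ0 - π0 = 0 ∧ σ1 - π1 = 0 ∧ σ2 - π2 = 0) := by
    rintro ⟨i1, i2, i3⟩
    apply hrp
    rw [hrσ, hpπ, sub_eq_zero.1 i1, sub_eq_zero.1 i2, sub_eq_zero.1 i3]
  obtain ⟨k, hk, k0, k1, k2, kz⟩ := exit_lem hσ0 hσ1 hσ2
    (d0 := σ0 - π0) (d1 := σ1 - π1) (d2 := σ2 - π2) (by linarith) hne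
  have lin : ∀ m : ℝ, p + m • (r - p) = (π0 + m * (σ0 - π0)) • t.A + (π1 + m * (σ1 - π1)) • t.B
      + (π2 + m * (σ2 - π2)) • t.C := by
    intro m; rw [hrσ, hpπ]; module
  have lins : ∀ m : ℝ, (π0 + m * (σ0 - π0)) + (π1 + m * (σ1 - π1)) + (π2 + m * (σ2 - π2)) = 1 := by
    intro m; linear_combination (1 - m) * hπs + m * hσs
  have linP : ∀ m : ℝ, p + m • (r - p) ∈ Pl t := fun m => ⟨_, _, _, lins m, lin m⟩
  have hpP : p ∈ Pl s := hull_sub_Pl s hp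
  have hrP : r ∈ Pl s := hull_sub_Pl s (outl_sub_hull s hr')
  have linPs : ∀ m : ℝ, p + m • (r - p) ∈ Pl s := by
    intro m
    have := Pl_comb hpP hrP hrP (a := 1 - m) (b := m) (c := 0) (by ring)
    convert this using 1; module
  set e : Pt := ((1 + k) / 2) • (r - p) with he
  have he2 : ∀ m : ℝ, p + m • e = p + (m * ((1 + k) / 2)) • (r - p) := by
    intro m; rw [he]; module
  have hqe : p + (2 : ℝ) • e = p + (1 + k) • (r - p) := by
    rw [he2]; congr 2; ring
  have hqt : p + (2 : ℝ) • e ∈ t.hull := by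
    rw [hqe]
    refine hull3.2 ⟨_, _, _, ?_, ?_, ?_, lins (1 + k), lin (1 + k)⟩ <;> linarith
  have hq : p + (2 : ℝ) • e ∉ s.hull := by
    intro h
    obtain ⟨a, b, c, ha, hb, hc, h1, hq⟩ := hull3.1 h
    have hk' : (1 + k) ≠ 0 := by positivity
    have : (a + k * α) • s.A + (b + k * β) • s.B + (c + k * γ) • s.C =
        ((1 + k) * ρ0) • s.A + ((1 + k) * ρ1) • s.B + ((1 + k) * ρ2) • s.C := by
      have e1 : (a + k * α) • s.A + (b + k * β) • s.B + (c + k * γ) • s.C =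
        (a • s.A + b • s.B + c • s.C) + k • (α • s.A + β • s.B + γ • s.C) := by module
      have e2 : ((1 + k) * ρ0) • s.A + ((1 + k) * ρ1) • s.B + ((1 + k) * ρ2) • s.C =
        (1 + k) • (ρ0 • s.A + ρ1 • s.B + ρ2 • s.C) := by module
      rw [e1, e2, ← hq, ← hpα, ← hrρ, hqe]; module
    obtain ⟨j1, j2, j3⟩ := s.nc (a + k * α - (1 + k) * ρ0) (b + k * β - (1 + k) * ρ1)
      (c + k * γ - (1 + k) * ρ2) (by linear_combination h1 + k * hα1 - (1 + k) * hρs) (by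
      rw [← sub_eq_zero.2 this]; module)
    have m1 := mul_pos hk hα
    have m2 := mul_pos hk hβ
    have m3 := mul_pos hk hγ
    rcases hρz with h | h | h
    · rw [h] at j1; linarith
    · rw [h] at j2; linarith
    · rw [h] at j3; linarith
  have hcop : ¬ Pl t ⊆ Pl s := fun h => hq (all_in hd hp hp' h hqt)
  have hO : ∀ x ∈ t.outline, x ∈ Pl s → x = p ∨ x = p + (2 : ℝ) • e := by
    intro x hx hxs
    have hxt : x ∈ Pl t := hull_sub_Pl t (outl_sub_hull t hx)
    by_cases hl : x ∈ affineSpan ℝ ({p, r} : Set Pt)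
    · obtain ⟨m, hm⟩ := mem_affineSpan_pair_iff_exists_lineMap_eq.1 hl
      have hm' : x = p + m • (r - p) := by
        rw [← hm, AffineMap.lineMap_apply_module]; module
      obtain ⟨ξ0, ξ1, ξ2, hξ0, hξ1, hξ2, hξs, hxξ, hξz⟩ := (outl (s := t) rfl).1 hx
      obtain ⟨j1, j2, j3⟩ := coord_unique t hξs (lins m) (by rw [← hxξ, hm', lin])
      rw [j1] at hξ0; rw [j2] at hξ1; rw [j3] at hξ2
      rw [j1, j2, j3] at hξz
      have lo : 0 ≤ m := by
        rcases hπz with h | h | h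
        · exact line_lo h hσ0 hξ0
        · exact line_lo h hσ1 hξ1
        · exact line_lo h hσ2 hξ2
      have hi : m ≤ 1 + k := by
        rcases kz with h | h | h
        · exact line_hi hσ0 hk h hξ0
        · exact line_hi hσ1 hk h hξ1
        · exact line_hi hσ2 hk h hξ2
      rcases lo.eq_or_lt with h | h
      · left; rw [hm', ← h]; simp
      rcases hi.eq_or_lt with h' | h'
      · right; rw [hm', h', hqe]
      exfalso
      have l0 := line_pos hπ0 hσ0 hk k0 h h'
      have l1 := line_pos hπ1 hσ1 hk k1 h h'
      have l2 := line_pos hπ2 hσ2 hk k2 h h'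
      rcases hξz with h | h | h <;> linarith
    · exfalso
      apply hcop
      refine coplane (nc_of_notMem hrp hl) ?_ ?_
      · rintro w (rfl | rfl | rfl)
        exacts [hpP, hrP, hxs]
      · rintro w (rfl | rfl | rfl)
        exacts [hull_sub_Pl t (outl_sub_hull t hp'), hull_sub_Pl t hr, hxt]
  have lin1 : ∀ m : ℝ, p + m • e ∈ Pl t := by intro m; rw [he2]; exact linP _
  have lin2 : ∀ m : ℝ, p + m • e ∈ Pl s := by intro m; rw [he2]; exact linPs _
  obtain ⟨s', e2, he2P, hs', hMs⟩ := planar hα hβ hγ hα1 hpα hq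
    (by simpa using lin2 1) hO
  have ncs := nc_of_vs hs'
  have ind : ∀ x y : ℝ, x • e + y • e2 = 0 → x = 0 ∧ y = 0 := by
    intro x y h
    obtain ⟨j1, j2, j3⟩ := ncs (x / 2) (-x / 4 + y / 2) (-x / 4 - y / 2) (by ring) (by
      rw [← h]; module)
    exact ⟨by linarith, by linarith⟩
  have off : ∀ x y : ℝ, p + x • e + y • e2 ∈ Pl t → y = 0 := by
    intro x y h
    by_contra hy
    apply hcop
    have hnc : NC p (p + e) (p + x • e + y • e2) := by
      intro a b c h0 h1
      obtain ⟨j1, j2⟩ := ind (b + c * x) (c * y) (by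
        have : a • p + b • (p + e) + c • (p + x • e + y • e2) =
          (a + b + c) • p + ((b + c * x) • e + (c * y) • e2) := by module
        rw [this, h0] at h1
        simpa using h1)
      have hc : c = 0 := by simpa [hy] using j2
      rw [hc] at j1 h0
      exact ⟨by linarith, by linarith, hc⟩
    refine coplane hnc ?_ ?_
    · rintro w (rfl | rfl | rfl)
      · exact hpP
      · simpa using lin2 1
      · have := Pl_comb hpP (lin2 x) he2P (a := -y) (b := 1) (c := y) (by ring)
        convert this using 1; module
    · rintro w (rfl | rfl | rfl)
      · simpa using lin1 0
      · simpa using lin1 1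
      · exact h
  have hh : 0 < (1 + k) / 2 ∧ (1 + k) / 2 < 1 + k := ⟨by linarith, by linarith⟩
  have l0 := line_pos hπ0 hσ0 hk k0 hh.1 hh.2
  have l1 := line_pos hπ1 hσ1 hk k1 hh.1 hh.2
  have l2 := line_pos hπ2 hσ2 hk k2 hh.1 hh.2
  have hpe : p + e = (π0 + (1 + k) / 2 * (σ0 - π0)) • t.A +
      (π1 + (1 + k) / 2 * (σ1 - π1)) • t.B + (π2 + (1 + k) / 2 * (σ2 - π2)) • t.C := by
    rw [he]; exact lin _
  have e4 : p + e + (2 : ℝ) • (-e) = p + (-1 : ℝ) • e := by module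
  have hq' : p + e + (2 : ℝ) • (-e) ∉ t.hull := by
    rw [e4, he2]
    intro h
    obtain ⟨a, b, c, ha, hb, hc, h1, hh1⟩ := hull3.1 h
    obtain ⟨j1, j2, j3⟩ := coord_unique t h1 (lins _) (by rw [← hh1, lin])
    rw [j1] at ha; rw [j2] at hb; rw [j3] at hc
    have : 0 ≤ -1 * ((1 + k) / 2) := by
      rcases hπz with h | h | h
      · exact line_lo h hσ0 ha
      · exact line_lo h hσ1 hb
      · exact line_lo h hσ2 hc
    linarith
  have hO' : ∀ x ∈ s'.outline, x ∈ Pl t → x = p + e ∨ x = p + e + (2 : ℝ) • (-e) := by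
    intro x hx hxt
    obtain ⟨a, b, c, ha, hb, hc, h1, hxe, hz⟩ := (outl hs').1 hx
    have ha1 : a = 1 - b - c := by linarith
    have hxe' : x = p + (a - b - c) • e + (b - c) • e2 := by
      rw [hxe, ha1]; module
    have hbc := off (a - b - c) (b - c) (hxe' ▸ hxt)
    have hbc' : b = c := by linarith
    rw [hxe', hbc, e4]
    rcases hz with h | h | h
    · right
      have : a - b - c = -1 := by linarith
      rw [this]; module
    · left
      have : a - b - c = 1 := by linarith
      rw [this]; module
    · left
      have : a - b - c = 1 := by linarith
      rw [this]; module
  obtain ⟨t', e3, he3P, ht', hMt⟩ := planar l0 l1 l2 (lins _) hpe hq'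
    (by simpa using lin1 0) hO'
  have nct := nc_of_vs ht'
  have hi : Ind3 e e2 e3 := by
    intro x y z h
    have hy : y = 0 := by
      apply off x y
      have h2 : p + x • e + y • e2 = p + (-z) • e3 := by
        have : p + x • e + y • e2 = p + (x • e + y • e2 + z • e3) + (-z) • e3 := by module
        rw [this, h]; simp
      rw [h2]
      have := Pl_comb (lin1 0) (lin1 1) he3P (a := 1) (b := z) (c := -z) (by ring)
      convert this using 1; module
    rw [hy] at h
    obtain ⟨j1, j2, j3⟩ := nct (-x / 2) (x / 4 + z / 2) (x / 4 - z / 2) (by ring) (by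
      rw [← h]; module)
    exact ⟨by linarith, hy, by linarith⟩
  have hs2 : s'.vertexSet =
      {Fr p e e2 e3 (1, 0, 0), Fr p e e2 e3 (-1, 1, 0), Fr p e e2 e3 (-1, -1, 0)} := by
    rw [hs']
    congr 1
    · simp [Fr]
    congr 1
    · simp only [Fr]; module
    · congr 1; simp only [Fr]; module
  have ht2 : t'.vertexSet =
      {Fr p e e2 e3 (0, 0, 0), Fr p e e2 e3 (2, 0, 1), Fr p e e2 e3 (2, 0, -1)} := by
    rw [ht']
    congr 1
    · simp [Fr]
    congr 1
    · simp only [Fr]; module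
    · congr 1; simp only [Fr]; module
  have hd' : Disjoint s'.outline t'.outline := by
    rw [Set.disjoint_left]
    intro x hx hx'
    obtain ⟨a, b, c, ha, hb, hc, h1, hxe, hz⟩ := (outl hs').1 hx
    obtain ⟨u, v, w, hu, hv, hw, h1', hxe', hz'⟩ := (outl ht').1 hx'
    have ha1 : a = 1 - b - c := by linarith
    have hu1 : u = 1 - v - w := by linarith
    obtain ⟨j1, j2, j3⟩ := hi (a - b - c - 2 * v - 2 * w) (b - c) (w - v) (by
      rw [← sub_eq_zero.2 (hxe.symm.trans hxe'), ha1, hu1]; module)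
    rcases hz with h | h | h <;> rcases hz' with h' | h' | h' <;> linarith
  have H : P s t s' t' := (M.left hMs).trans (M.right hMt)
  exact H.trans ((std_swap hi hs2 ht2 hd').trans H.symm.swap)

lemma swap_main {s t : Tri} (hd : Disjoint s.outline t.outline) : P s t t s := by
  by_cases h1 : Disjoint s.hull t.outline
  · exact unlinked h1
  by_cases h2 : Disjoint t.hull s.outline
  · exact (unlinked h2).swap
  obtain ⟨p, hp, hp'⟩ := Set.not_disjoint_iff.1 h1
  obtain ⟨r, hr, hr'⟩ := Set.not_disjoint_iff.1 h2
  exact linked hd hp hp' hr hr'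

/-- Any ordered linking `(Δ1, Δ2)` of two triangles is combinatorially isotopic to the
ordered linking `(Δ2, Δ1)`. -/
theorem stmt2 (T : Fin 2 → Tri) (hT : IsLinking T) :
    CombIsotopic T ![T 1, T 0] := by
  have h : P (T 0) (T 1) (T 1) (T 0) := swap_main (hT 0 1 (by decide))
  have e : T = ![T 0, T 1] := by
    funext i; fin_cases i <;> rfl
  have h' : CombIsotopic ![T 0, T 1] ![T 1, T 0] := h
  rw [← e] at h'
  exact h'
end
end

section
/- A linking of three triangles in ℝ³ is Borromean if and only if the triangles can be enumerated as Λ0, Λ1, Λ2 so that ∂Λ1 ∩ ⟨Λ2⟩ consists of exactly two points, ∂Λ2 ∩ ⟨Λ0⟩ consists of exactly two points, ∂Λ1 ∩ ⟨Λ0⟩ = ∅, and ⟨Λ0⟩ ∩ ⟨Λ1⟩ ∩ ⟨Λ2⟩ ≠ ∅. -/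
open scoped Matrix

noncomputable section

/-- A triple of triangles is Borromean if the three convex hulls have a common point and the
triangles can be enumerated `Δ0, Δ1, Δ2` so that each `∂Δj ∩ ⟨Δ_{(j+1) mod 3}⟩` consists of
exactly two points. -/
def IsBorromean (T : Fin 3 → Tri) : Prop :=
  ((T 0).hull ∩ (T 1).hull ∩ (T 2).hull).Nonempty ∧
  ∃ e : Equiv.Perm (Fin 3), ∀ j : Fin 3,
    ∃ P Q : Pt, P ≠ Q ∧ (T (e j)).outline ∩ (T (e (j + 1))).hull = {P, Q}

/-- A function respecting affine combinations of three points. -/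
def Aff (f : Pt → ℝ) : Prop :=
  ∀ (x y z : Pt) (p q r : ℝ), p + q + r = 1 →
    f (p • x + q • y + r • z) = p * f x + q * f y + r * f z

theorem Aff.two {f : Pt → ℝ} (h : Aff f) (x y : Pt) (p q : ℝ) (hpq : p + q = 1) :
    f (p • x + q • y) = p * f x + q * f y := by
  have := h x y y p q 0 (by linarith)
  simpa using this

/-- Affine coordinates adapted to a triangle. -/
structure Crd (T : Tri) where
  a : Pt → ℝ
  b : Pt → ℝ
  c : Pt → ℝ
  d : Pt → ℝ
  fa : Aff a
  fb : Aff b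
  fc : Aff c
  fd : Aff d
  sum : ∀ x, a x + b x + c x = 1
  recon : ∀ x, d x = 0 → x = a x • T.A + b x • T.B + c x • T.C
  aA : a T.A = 1
  aB : a T.B = 0
  aC : a T.C = 0
  bA : b T.A = 0
  bB : b T.B = 1
  bC : b T.C = 0
  cA : c T.A = 0
  cB : c T.B = 0
  cC : c T.C = 1
  dA : d T.A = 0
  dB : d T.B = 0
  dC : d T.C = 0

theorem crd_of_vec (T : Tri) (m k n : Pt)
    (h1 : (T.B - T.A) ⬝ᵥ m = 1) (h2 : (T.C - T.A) ⬝ᵥ m = 0)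
    (h3 : (T.B - T.A) ⬝ᵥ k = 0) (h4 : (T.C - T.A) ⬝ᵥ k = 1)
    (h5 : (T.B - T.A) ⬝ᵥ n = 0) (h6 : (T.C - T.A) ⬝ᵥ n = 0)
    (h7 : ∀ x : Pt, x ⬝ᵥ n = 0 →
      x = (x ⬝ᵥ m) • (T.B - T.A) + (x ⬝ᵥ k) • (T.C - T.A)) : Nonempty (Crd T) := by
  have key : ∀ v : Pt, Aff (fun x => (x - T.A) ⬝ᵥ v) := by
    intro v x y z p q r h
    have : r = 1 - p - q := by linarith
    subst this
    simp [dotProduct, Fin.sum_univ_three]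
    ring
  refine ⟨⟨fun x => 1 - (x - T.A) ⬝ᵥ m - (x - T.A) ⬝ᵥ k, fun x => (x - T.A) ⬝ᵥ m,
    fun x => (x - T.A) ⬝ᵥ k, fun x => (x - T.A) ⬝ᵥ n, ?_, key m, key k, key n, ?_, ?_,
    ?_, ?_, ?_, ?_, ?_, ?_, ?_, ?_, ?_, ?_, ?_, ?_⟩⟩
  · intro x y z p q r h
    have e1 := key m x y z p q r h
    have e2 := key k x y z p q r h
    simp only at e1 e2 ⊢
    rw [e1, e2]
    linear_combination -h
  · intro x; ring
  · intro x hx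
    have := h7 _ hx
    have h' : x = T.A + (x - T.A) := by module
    calc x = T.A + (x - T.A) := h'
      _ = T.A + (((x - T.A) ⬝ᵥ m) • (T.B - T.A) + ((x - T.A) ⬝ᵥ k) • (T.C - T.A)) := by
        rw [← this]
      _ = _ := by module
  all_goals simp [h1, h2, h3, h4, h5, h6]

theorem exists_crd (T : Tri) : Nonempty (Crd T) := by
  have hl : LinearIndependent ℝ ![T.B - T.A, T.C - T.A] := by
    have h := (affineIndependent_iff_linearIndependent_vsub ℝ ![T.A, T.B, T.C] 0).1 T.indep
    have h' := h.comp (fun i : Fin 2 => (⟨i.succ, Fin.succ_ne_zero i⟩ : {x : Fin 3 // x ≠ 0}))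
      (by intro i j hij; simpa using hij)
    have e : ![T.B - T.A, T.C - T.A] = ((fun i : {x : Fin 3 // x ≠ 0} =>
        ![T.A, T.B, T.C] (i : Fin 3) -ᵥ ![T.A, T.B, T.C] 0) ∘
        fun i : Fin 2 => (⟨i.succ, Fin.succ_ne_zero i⟩ : {x : Fin 3 // x ≠ 0})) := by
      ext i j
      fin_cases i <;> simp
    rw [e]
    exact h'
  have hn := (crossProduct_ne_zero_iff_linearIndependent).2 hl
  set u := T.B - T.A with hu
  set w := T.C - T.A with hw
  have hN : (u ⨯₃ w) ⬝ᵥ (u ⨯₃ w) ≠ 0 := fun h => hn (dotProduct_self_eq_zero.1 h)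
  set N := (u ⨯₃ w) ⬝ᵥ (u ⨯₃ w) with hNd
  refine crd_of_vec T (N⁻¹ • (w ⨯₃ (u ⨯₃ w))) (N⁻¹ • ((u ⨯₃ w) ⨯₃ u)) (u ⨯₃ w) ?_ ?_ ?_ ?_ ?_ ?_ ?_
  · rw [← hu, dotProduct_smul, smul_eq_mul, inv_mul_eq_one₀ hN, hNd]
    simp [crossProduct, dotProduct, Fin.sum_univ_three]; ring
  · rw [← hw, dotProduct_smul]
    simp [crossProduct, dotProduct, Fin.sum_univ_three]; right; ring
  · rw [← hu, dotProduct_smul]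
    simp [crossProduct, dotProduct, Fin.sum_univ_three]; right; ring
  · rw [← hw, dotProduct_smul, smul_eq_mul, inv_mul_eq_one₀ hN, hNd]
    simp [crossProduct, dotProduct, Fin.sum_univ_three]; ring
  · rw [← hu]
    simp [crossProduct, dotProduct, Fin.sum_univ_three]; ring
  · rw [← hw]
    simp [crossProduct, dotProduct, Fin.sum_univ_three]; ring
  · intro x hx
    rw [← hu, ← hw]
    have : N • x = (x ⬝ᵥ (w ⨯₃ (u ⨯₃ w))) • u + (x ⬝ᵥ ((u ⨯₃ w) ⨯₃ u)) • w
        + (x ⬝ᵥ (u ⨯₃ w)) • (u ⨯₃ w) := by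
      rw [hNd]
      ext i
      fin_cases i <;> simp [crossProduct, dotProduct, Fin.sum_univ_three] <;> ring
    rw [hx, zero_smul, add_zero] at this
    have h2 : x = N⁻¹ • (N • x) := by rw [smul_smul, inv_mul_cancel₀ hN, one_smul]
    rw [dotProduct_smul, dotProduct_smul]
    nth_rewrite 1 [h2]
    rw [this]
    simp only [smul_eq_mul]
    module

namespace Crd
variable {T : Tri} (k : Crd T)

theorem hull_iff (x : Pt) :
    x ∈ T.hull ↔ 0 ≤ k.a x ∧ 0 ≤ k.b x ∧ 0 ≤ k.c x ∧ k.d x = 0 := by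
  constructor
  · intro hx
    have hc : Convex ℝ {x | 0 ≤ k.a x ∧ 0 ≤ k.b x ∧ 0 ≤ k.c x ∧ k.d x = 0} := by
      rintro x ⟨x1, x2, x3, x4⟩ y ⟨y1, y2, y3, y4⟩ p q hp hq hpq
      simp only [Set.mem_ofPred_eq, k.fa.two x y p q hpq, k.fb.two x y p q hpq,
        k.fc.two x y p q hpq, k.fd.two x y p q hpq, x4, y4]
      refine ⟨by positivity, by positivity, by positivity, by simp⟩
    refine convexHull_min ?_ hc hx
    rintro y (rfl | rfl | rfl) <;>
      simp [k.aA, k.aB, k.aC, k.bA, k.bB, k.bC, k.cA, k.cB, k.cC, k.dA, k.dB, k.dC]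
  · rintro ⟨h1, h2, h3, h4⟩
    rw [k.recon x h4]
    have hc := convex_convexHull ℝ ({T.A, T.B, T.C} : Set Pt)
    have hs : ({T.A, T.B, T.C} : Set Pt) ⊆ _ := subset_convexHull ℝ _
    have := hc.sum_mem (t := Finset.univ) (w := ![k.a x, k.b x, k.c x]) (z := ![T.A, T.B, T.C])
      (by intro i _; fin_cases i <;> simpa) (by simp [Fin.sum_univ_three, k.sum])
      (by intro i _; apply hs; fin_cases i <;> simp)
    simpa [Fin.sum_univ_three, Tri.hull] using this

theorem outline_iff (x : Pt) :
    x ∈ T.outline ↔ x ∈ T.hull ∧ (k.a x = 0 ∨ k.b x = 0 ∨ k.c x = 0) := by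
  rw [k.hull_iff]
  constructor
  · rintro ((⟨p, q, hp, hq, hpq, rfl⟩ | ⟨p, q, hp, hq, hpq, rfl⟩) | ⟨p, q, hp, hq, hpq, rfl⟩) <;>
      simp only [k.fa.two _ _ p q hpq, k.fb.two _ _ p q hpq,
        k.fc.two _ _ p q hpq, k.fd.two _ _ p q hpq] <;>
      simp [k.aA, k.aB, k.aC, k.bA, k.bB, k.bC, k.cA, k.cB, k.cC, k.dA, k.dB, k.dC, hp, hq]
  · rintro ⟨⟨h1, h2, h3, h4⟩, h⟩
    have hr := k.recon x h4
    have hs := k.sum x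
    rcases h with h | h | h <;> rw [h] at hr hs
    · left; right
      exact ⟨k.b x, k.c x, h2, h3, by linarith, by simpa using hr.symm⟩
    · right
      exact ⟨k.c x, k.a x, h3, h1, by linarith, by rw [add_comm]; simpa using hr.symm⟩
    · left; left
      exact ⟨k.a x, k.b x, h1, h2, by linarith, by simpa using hr.symm⟩

/-- Faces are extreme. -/
theorem face (k : Crd T) {P Q : Pt} {p q : ℝ} (hp : 0 < p) (hq : 0 < q) (hpq : p + q = 1)
    (hP : P ∈ T.hull) (hQ : Q ∈ T.hull) (hR : p • P + q • Q ∈ T.outline) : P ∈ T.outline := by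
  rw [k.outline_iff] at hR ⊢
  refine ⟨hP, ?_⟩
  rw [k.hull_iff] at hP hQ
  rw [k.fa.two _ _ p q hpq, k.fb.two _ _ p q hpq, k.fc.two _ _ p q hpq] at hR
  have aux : ∀ s t : ℝ, 0 ≤ s → 0 ≤ t → p * s + q * t = 0 → s = 0 := by
    intro s t hs ht h
    have : p * s = 0 := by nlinarith [mul_nonneg hp.le hs, mul_nonneg hq.le ht]
    rcases mul_eq_zero.1 this with h | h
    · linarith
    · exact h
  rcases hR.2 with h | h | h
  · exact Or.inl (aux _ _ hP.1 hQ.1 h)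
  · exact Or.inr (Or.inl (aux _ _ hP.2.1 hQ.2.1 h))
  · exact Or.inr (Or.inr (aux _ _ hP.2.2.1 hQ.2.2.1 h))

/-- Leaving the triangle inside its plane crosses the outline. -/
theorem cross {X Y : Pt} (hX : X ∈ T.hull) (hY : k.d Y = 0) (hY' : Y ∉ T.hull) :
    ∃ Z ∈ segment ℝ X Y, Z ∈ T.outline := by
  have hX' := (k.hull_iff X).1 hX
  set f : ℝ → ℝ := fun t => min ((1 - t) * k.a X + t * k.a Y)
    (min ((1 - t) * k.b X + t * k.b Y) ((1 - t) * k.c X + t * k.c Y)) with hf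
  have hcont : Continuous f := by fun_prop
  have h0 : 0 ≤ f 0 := by simp [hf, hX'.1, hX'.2.1, hX'.2.2.1]
  have h1 : f 1 ≤ 0 := by
    by_contra h
    apply hY'
    rw [k.hull_iff]
    simp [hf] at h
    exact ⟨h.1.le, h.2.1.le, h.2.2.le, hY⟩
  obtain ⟨t, ⟨ht0, ht1⟩, ht⟩ := intermediate_value_Icc' zero_le_one hcont.continuousOn ⟨h1, h0⟩
  have hs : (1 - t) + t = 1 := by ring
  refine ⟨(1 - t) • X + t • Y, ⟨1 - t, t, by linarith, ht0, hs, rfl⟩, ?_⟩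
  rw [k.outline_iff, k.hull_iff, k.fa.two _ _ _ _ hs, k.fb.two _ _ _ _ hs, k.fc.two _ _ _ _ hs,
    k.fd.two _ _ _ _ hs, hY, hX'.2.2.2]
  simp only [hf] at ht
  have e1 := min_le_left ((1 - t) * k.a X + t * k.a Y)
    (min ((1 - t) * k.b X + t * k.b Y) ((1 - t) * k.c X + t * k.c Y))
  have e2 := min_le_right ((1 - t) * k.a X + t * k.a Y)
    (min ((1 - t) * k.b X + t * k.b Y) ((1 - t) * k.c X + t * k.c Y))
  have e3 := min_le_left ((1 - t) * k.b X + t * k.b Y) ((1 - t) * k.c X + t * k.c Y)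
  have e4 := min_le_right ((1 - t) * k.b X + t * k.b Y) ((1 - t) * k.c X + t * k.c Y)
  refine ⟨⟨by linarith, by linarith, by linarith, by simp⟩, ?_⟩
  rcases min_choice ((1 - t) * k.a X + t * k.a Y)
    (min ((1 - t) * k.b X + t * k.b Y) ((1 - t) * k.c X + t * k.c Y)) with h | h
  · left; linarith
  · rcases min_choice ((1 - t) * k.b X + t * k.b Y) ((1 - t) * k.c X + t * k.c Y) with h' | h'
    · right; left; linarith
    · right; right; linarith

theorem d_eq (x : Pt) (hx : k.d x = 0) (f : Pt → ℝ) (hf : Aff f) :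
    f x = k.a x * f T.A + k.b x * f T.B + k.c x * f T.C := by
  conv_lhs => rw [k.recon x hx]
  exact hf _ _ _ _ _ _ (k.sum x)

/-- Points in the plane with vanishing `f` are on one line. -/
theorem line {f : Pt → ℝ} (hf : Aff f) (hne : ¬ (f T.A = f T.B ∧ f T.B = f T.C))
    {P R : Pt} (hP : k.d P = 0) (hfP : f P = 0) (hR : k.d R = 0) (hfR : f R = 0) :
    ∃ s : ℝ, R = P + s • ((f T.B - f T.C) • T.A + (f T.C - f T.A) • T.B
      + (f T.A - f T.B) • T.C) := by
  have h1 := k.d_eq P hP f hf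
  have h2 := k.d_eq R hR f hf
  have s1 := k.sum P
  have s2 := k.sum R
  rw [hfP] at h1
  rw [hfR] at h2
  set α := f T.A
  set β := f T.B
  set γ := f T.C
  have hs : ∃ s : ℝ, k.a R - k.a P = s * (β - γ) ∧ k.b R - k.b P = s * (γ - α) ∧
      k.c R - k.c P = s * (α - β) := by
    by_cases hab : α = β
    · have hbc : β - γ ≠ 0 := fun h => hne ⟨hab, by linarith⟩
      refine ⟨(k.a R - k.a P) / (β - γ), ?_, ?_, ?_⟩
      · field_simp
      · field_simp
        rw [hab] at h1 h2 ⊢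
        have : (k.a R - k.a P + (k.b R - k.b P)) * (β - γ) = 0 := by
          linear_combination h1 - h2 - γ * (s2 - s1)
        linear_combination this
      · have : (k.c R - k.c P) * (β - γ) = 0 := by
          rw [hab] at h1 h2
          linear_combination β * (s2 - s1) - (h1 - h2)
        rcases mul_eq_zero.1 this with h | h
        · rw [h, hab]; ring
        · exact absurd h hbc
    · have hab' : α - β ≠ 0 := sub_ne_zero.2 hab
      refine ⟨(k.c R - k.c P) / (α - β), ?_, ?_, ?_⟩
      · field_simp
        linear_combination (h1 - h2) - β * (s2 - s1)
      · field_simp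
        linear_combination α * (s2 - s1) - (h1 - h2)
      · field_simp
  obtain ⟨s, e1, e2, e3⟩ := hs
  refine ⟨s, ?_⟩
  conv_lhs => rw [k.recon R hR]
  conv_rhs => rw [k.recon P hP]
  rw [show k.a R = k.a P + s * (β - γ) by linarith, show k.b R = k.b P + s * (γ - α) by linarith,
    show k.c R = k.c P + s * (α - β) by linarith]
  module

end Crd

theorem hull_convex (T : Tri) : Convex ℝ T.hull := convex_convexHull ℝ _

theorem outline_sub_hull {T : Tri} {x : Pt} (h : x ∈ T.outline) : x ∈ T.hull := by
  obtain ⟨k⟩ := exists_crd T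
  exact ((k.outline_iff x).1 h).1

theorem face' {T : Tri} {P Q R : Pt} {p q : ℝ} (hp : 0 < p) (hq : 0 < q) (hpq : p + q = 1)
    (hP : P ∈ T.hull) (hQ : Q ∈ T.hull) (hR : R ∈ T.outline) (e : R = p • P + q • Q) :
    P ∈ T.outline ∧ Q ∈ T.outline := by
  obtain ⟨k⟩ := exists_crd T
  subst e
  exact ⟨k.face hp hq hpq hP hQ hR,
    k.face hq hp (by linarith) hQ hP (by rwa [add_comm])⟩

theorem exists_edge {S : Tri} (kS : Crd S) {P : Pt} (hP : P ∈ S.outline) :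
    ∃ U, (U = S.A ∨ U = S.B ∨ U = S.C) ∧ U ≠ P ∧ segment ℝ P U ⊆ S.outline := by
  have aux : ∀ U V : Pt, U ≠ V → (U = S.A ∨ U = S.B ∨ U = S.C) → (V = S.A ∨ V = S.B ∨ V = S.C) →
      segment ℝ U V ⊆ S.outline → P ∈ segment ℝ U V →
      ∃ U, (U = S.A ∨ U = S.B ∨ U = S.C) ∧ U ≠ P ∧ segment ℝ P U ⊆ S.outline := by
    intro U V hUV hU hV hs hPm
    by_cases h : U = P
    · refine ⟨V, hV, fun h' => hUV (h.trans h'.symm), ?_⟩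
      exact ((convex_segment U V).segment_subset hPm (right_mem_segment ℝ U V)).trans hs
    · refine ⟨U, hU, h, ?_⟩
      exact ((convex_segment U V).segment_subset hPm (left_mem_segment ℝ U V)).trans hs
  have nAB : S.A ≠ S.B := fun h => by have := kS.aA; rw [h, kS.aB] at this; norm_num at this
  have nBC : S.B ≠ S.C := fun h => by have := kS.bB; rw [h, kS.bC] at this; norm_num at this
  have nCA : S.C ≠ S.A := fun h => by have := kS.aA; rw [← h, kS.aC] at this; norm_num at this
  have hP' := hP
  rcases hP' with (h | h) | h
  · exact aux S.A S.B nAB (by simp) (by simp) (fun x hx => Or.inl (Or.inl hx)) h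
  · exact aux S.B S.C nBC (by simp) (by simp) (fun x hx => Or.inl (Or.inr hx)) h
  · exact aux S.C S.A nCA (by simp) (by simp) (fun x hx => Or.inr hx) h

theorem not_coplanar {S T : Tri} (kS : Crd S) (kT : Crd T) (hd : Disjoint S.outline T.outline)
    {P Q : Pt} (h : S.outline ∩ T.hull = {P, Q}) :
    ¬ (kT.d S.A = kT.d S.B ∧ kT.d S.B = kT.d S.C) := by
  rintro ⟨e1, e2⟩
  have hP : P ∈ S.outline ∩ T.hull := by rw [h]; simp
  have hPS := (kS.hull_iff P).1 (outline_sub_hull hP.1)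
  have hPT := (kT.hull_iff P).1 hP.2
  have hv := kS.d_eq P hPS.2.2.2 kT.d kT.fd
  rw [hPT.2.2.2, e1, e2] at hv
  have hC : kT.d S.C = 0 := by
    have := kS.sum P
    linear_combination -hv - kT.d S.C * this
  obtain ⟨U, hU, hUP, hs⟩ := exists_edge kS hP.1
  have hU0 : kT.d U = 0 := by
    rcases hU with rfl | rfl | rfl <;> linarith
  have hUT : U ∈ T.hull := by
    by_contra hn
    obtain ⟨Z, hZ, hZ'⟩ := kT.cross hP.2 hU0 hn
    exact Set.disjoint_left.1 hd (hs hZ) hZ'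
  have hU1 : U ∈ ({P, Q} : Set Pt) := h ▸ ⟨hs (right_mem_segment ℝ P U), hUT⟩
  have hMs : (1/2 : ℝ) • P + (1/2 : ℝ) • U ∈ segment ℝ P U :=
    ⟨1/2, 1/2, by norm_num, by norm_num, by norm_num, rfl⟩
  have hM1 : (1/2 : ℝ) • P + (1/2 : ℝ) • U ∈ ({P, Q} : Set Pt) :=
    h ▸ ⟨hs hMs, (hull_convex T).segment_subset hP.2 hUT hMs⟩
  have hUQ : U = Q := by
    rcases hU1 with h | h
    · exact absurd h hUP
    · exact h
  apply hUP
  rcases hM1 with h | h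
  · calc U = (2 : ℝ) • ((1/2 : ℝ) • P + (1/2 : ℝ) • U) - P := by module
      _ = (2 : ℝ) • P - P := by rw [h]
      _ = P := by module
  · rw [Set.mem_singleton_iff, ← hUQ] at h
    calc U = (2 : ℝ) • U - U := by module
      _ = (2 : ℝ) • ((1/2 : ℝ) • P + (1/2 : ℝ) • U) - U := by rw [h]
      _ = P := by module

theorem inter_seg {S T : Tri} (hd : Disjoint S.outline T.outline)
    {P Q : Pt} (hPQ : P ≠ Q) (h : S.outline ∩ T.hull = {P, Q}) {R : Pt}
    (hRS : R ∈ S.hull) (hRT : R ∈ T.hull) : R ∈ segment ℝ P Q := by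
  obtain ⟨kS⟩ := exists_crd S
  obtain ⟨kT⟩ := exists_crd T
  have hn := not_coplanar kS kT hd h
  have hP : P ∈ S.outline ∩ T.hull := by rw [h]; simp
  have hQ : Q ∈ S.outline ∩ T.hull := by rw [h]; simp
  have hPS := outline_sub_hull hP.1
  have hQS := outline_sub_hull hQ.1
  have dS : ∀ x ∈ S.hull, kS.d x = 0 := fun x hx => ((kS.hull_iff x).1 hx).2.2.2
  have dT : ∀ x ∈ T.hull, kT.d x = 0 := fun x hx => ((kT.hull_iff x).1 hx).2.2.2
  obtain ⟨s, hs⟩ := kS.line kT.fd hn (dS P hPS) (dT P hP.2) (dS Q hQS) (dT Q hQ.2)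
  obtain ⟨t, ht⟩ := kS.line kT.fd hn (dS P hPS) (dT P hP.2) (dS R hRS) (dT R hRT)
  have hs0 : s ≠ 0 := by
    rintro rfl
    apply hPQ
    simpa using hs.symm
  have hR : R = (1 - t / s) • P + (t / s) • Q := by
    rw [ht, hs]
    match_scalars <;> field_simp <;> ring
  clear ht
  generalize t / s = r at hR
  have fin : R ∈ S.outline → R ∈ segment ℝ P Q := by
    intro hRo
    have : R ∈ ({P, Q} : Set Pt) := h ▸ ⟨hRo, hRT⟩
    rcases this with h | h
    · rw [h]; exact left_mem_segment ℝ P Q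
    · rw [Set.mem_singleton_iff.1 h]; exact right_mem_segment ℝ P Q
  by_cases h0 : r < 0
  · -- P between R and Q
    have h1 : 0 < 1 - r := by linarith
    apply fin
    refine (face' (p := 1 / (1 - r)) (q := -r / (1 - r)) (by positivity)
      (div_pos (by linarith) h1) (by field_simp; ring) hRS hQS hP.1 ?_).1
    rw [hR]
    match_scalars <;> field_simp <;> ring
  by_cases h1 : 1 < r
  · have h1' : 0 < r := by linarith
    apply fin
    refine (face' (p := 1 / r) (q := (r - 1) / r) (by positivity)
      (div_pos (by linarith) h1') (by field_simp; ring) hRS hPS hQ.1 ?_).1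
    rw [hR]
    match_scalars <;> field_simp <;> ring
  exact ⟨1 - r, r, by linarith, by linarith, by ring, hR.symm⟩

theorem lemA {S T : Tri} (hd : Disjoint S.outline T.outline)
    {P Q : Pt} (hPQ : P ≠ Q) (h : S.outline ∩ T.hull = {P, Q}) :
    T.outline ∩ S.hull = ∅ := by
  rw [Set.eq_empty_iff_forall_notMem]
  rintro R ⟨hRT, hRS⟩
  have hP : P ∈ S.outline ∩ T.hull := by rw [h]; simp
  have hQ : Q ∈ S.outline ∩ T.hull := by rw [h]; simp
  obtain ⟨p, q, hp, hq, hpq, e⟩ := inter_seg hd hPQ h hRS (outline_sub_hull hRT)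
  rcases hp.eq_or_lt with h0 | hp
  · subst h0
    have : q = 1 := by linarith
    subst this
    have : Q = R := by simpa using e
    exact Set.disjoint_left.1 hd hQ.1 (this ▸ hRT)
  rcases hq.eq_or_lt with h0 | hq
  · subst h0
    have : p = 1 := by linarith
    subst this
    have : P = R := by simpa using e
    exact Set.disjoint_left.1 hd hP.1 (this ▸ hRT)
  exact Set.disjoint_left.1 hd hP.1 (face' hp hq hpq hP.2 hQ.2 hRT e.symm).1

/-- Two points of the outline on a ray from a non-outline point of the hull coincide. -/
theorem ray_unique {T : Tri} {X v : Pt} (hX : X ∈ T.hull) (hX' : X ∉ T.outline) {s t : ℝ}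
    (hs : 0 < s) (hst : s < t) (h1 : X + s • v ∈ T.outline) (h2 : X + t • v ∈ T.hull) : False := by
  have ht : 0 < t := hs.trans hst
  refine hX' (face' (p := (t - s) / t) (q := s / t) (div_pos (by linarith) ht) (by positivity)
    (by field_simp; ring) hX h2 h1 ?_).1
  match_scalars <;> field_simp <;> ring

/-- A ray in the plane of the triangle leaves it through the outline. -/
theorem ray_exit {T : Tri} (k : Crd T) {X : Pt} (hX : X ∈ T.hull) (hX' : X ∉ T.outline)
    {α β γ : ℝ} (hsum : α + β + γ = 0) (hne : ¬ (α = 0 ∧ β = 0 ∧ γ = 0)) :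
    ∃ t : ℝ, 0 < t ∧ X + t • (α • T.A + β • T.B + γ • T.C) ∈ T.outline := by
  have hXd := (k.hull_iff X).1 hX
  have hrec : ∀ t : ℝ, X + t • (α • T.A + β • T.B + γ • T.C) =
      (k.a X + t * α) • T.A + (k.b X + t * β) • T.B + (k.c X + t * γ) • T.C := by
    intro t
    nth_rewrite 1 [k.recon X hXd.2.2.2]
    module
  have hs1 : ∀ t : ℝ, (k.a X + t * α) + (k.b X + t * β) + (k.c X + t * γ) = 1 := by
    intro t; linear_combination k.sum X + t * hsum
  have ha : ∀ t : ℝ, k.a (X + t • (α • T.A + β • T.B + γ • T.C)) = k.a X + t * α := by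
    intro t; rw [hrec, k.fa _ _ _ _ _ _ (hs1 t), k.aA, k.aB, k.aC]; ring
  have hb : ∀ t : ℝ, k.b (X + t • (α • T.A + β • T.B + γ • T.C)) = k.b X + t * β := by
    intro t; rw [hrec, k.fb _ _ _ _ _ _ (hs1 t), k.bA, k.bB, k.bC]; ring
  have hc : ∀ t : ℝ, k.c (X + t • (α • T.A + β • T.B + γ • T.C)) = k.c X + t * γ := by
    intro t; rw [hrec, k.fc _ _ _ _ _ _ (hs1 t), k.cA, k.cB, k.cC]; ring
  have hd : ∀ t : ℝ, k.d (X + t • (α • T.A + β • T.B + γ • T.C)) = 0 := by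
    intro t; rw [hrec, k.fd _ _ _ _ _ _ (hs1 t), k.dA, k.dB, k.dC]; ring
  have hneg : ∀ p q : ℝ, 0 ≤ p → q < 0 → ∃ t : ℝ, 0 < t ∧ p + t * q < 0 := by
    intro p q hp hq
    have hq' : 0 < -q := by linarith
    refine ⟨p / (-q) + 1, by positivity, ?_⟩
    have : p / (-q) * q = -p := by
      have := hq.ne
      field_simp
    linarith
  have hex : ∃ t : ℝ, 0 < t ∧ X + t • (α • T.A + β • T.B + γ • T.C) ∉ T.hull := by
    have : α < 0 ∨ β < 0 ∨ γ < 0 := by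
      by_contra! hcon
      exact hne ⟨by linarith [hcon.1, hcon.2.1, hcon.2.2], by linarith [hcon.1, hcon.2.1, hcon.2.2],
        by linarith [hcon.1, hcon.2.1, hcon.2.2]⟩
    rcases this with h | h | h
    · obtain ⟨t, ht, h⟩ := hneg _ _ hXd.1 h
      refine ⟨t, ht, fun hh => ?_⟩
      have := ((k.hull_iff _).1 hh).1
      rw [ha] at this; linarith
    · obtain ⟨t, ht, h⟩ := hneg _ _ hXd.2.1 h
      refine ⟨t, ht, fun hh => ?_⟩
      have := ((k.hull_iff _).1 hh).2.1
      rw [hb] at this; linarith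
    · obtain ⟨t, ht, h⟩ := hneg _ _ hXd.2.2.1 h
      refine ⟨t, ht, fun hh => ?_⟩
      have := ((k.hull_iff _).1 hh).2.2.1
      rw [hc] at this; linarith
  obtain ⟨t, ht, hh⟩ := hex
  obtain ⟨Z, ⟨p, q, hp, hq, hpq, rfl⟩, hZ⟩ := k.cross hX (hd t) hh
  have e : p • X + q • (X + t • (α • T.A + β • T.B + γ • T.C)) =
      X + (q * t) • (α • T.A + β • T.B + γ • T.C) := by
    have : p = 1 - q := by linarith
    rw [this]; module
  rw [e] at hZ
  refine ⟨q * t, ?_, hZ⟩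
  rcases hq.eq_or_lt with h0 | hq
  · exfalso; apply hX'
    simpa [← h0] using hZ
  · positivity

theorem lemB {T0 T1 T2 : Tri} (d12 : Disjoint T1.outline T2.outline)
    (d20 : Disjoint T2.outline T0.outline) {P Q P' Q' : Pt} (hPQ : P ≠ Q) (hPQ' : P' ≠ Q')
    (h12 : T1.outline ∩ T2.hull = {P, Q}) (h20 : T2.outline ∩ T0.hull = {P', Q'})
    (h10 : T1.outline ∩ T0.hull = ∅) {X : Pt} (x0 : X ∈ T0.hull) (x1 : X ∈ T1.hull)
    (x2 : X ∈ T2.hull) :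
    ∃ Y Z : Pt, Y ≠ Z ∧ T0.outline ∩ T1.hull = {Y, Z} := by
  have h21 := lemA d12 hPQ h12
  have h02 := lemA d20 hPQ' h20
  rw [Set.eq_empty_iff_forall_notMem] at h21 h02 h10
  obtain ⟨k0⟩ := exists_crd T0
  obtain ⟨k1⟩ := exists_crd T1
  have hX0 : X ∉ T0.outline := fun h => h02 X ⟨h, x2⟩
  have d0 : ∀ x ∈ T0.hull, k0.d x = 0 := fun x hx => ((k0.hull_iff x).1 hx).2.2.2
  have d1 : ∀ x ∈ T1.hull, k1.d x = 0 := fun x hx => ((k1.hull_iff x).1 hx).2.2.2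
  -- a point of the hull of `T0` in the plane of `T1` is in the hull of `T1`
  have stay : ∀ Y ∈ T0.hull, k1.d Y = 0 → Y ∈ T1.hull := by
    intro Y hY hd
    by_contra hn
    obtain ⟨Z, hZ, hZ'⟩ := k1.cross x1 hd hn
    exact h10 Z ⟨hZ', (hull_convex T0).segment_subset x0 hY hZ⟩
  have hne : ¬ (k1.d T0.A = k1.d T0.B ∧ k1.d T0.B = k1.d T0.C) := by
    rintro ⟨e1, e2⟩
    have hP : P' ∈ T2.outline ∩ T0.hull := by rw [h20]; simp
    have e3 := k0.d_eq X (d0 X x0) k1.d k1.fd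
    have e4 := k0.d_eq P' (d0 P' hP.2) k1.d k1.fd
    have : k1.d P' = 0 := by
      rw [d1 X x1, e1, e2] at e3
      rw [e1, e2] at e4
      linear_combination e4 - e3 + k1.d T0.C * (k0.sum P' - k0.sum X)
    exact h21 P' ⟨hP.1, stay P' hP.2 this⟩
  have hline := fun R (hR : R ∈ T0.hull) (hR' : R ∈ T1.hull) =>
    k0.line k1.fd hne (d0 X x0) (d1 X x1) (d0 R hR) (d1 R hR')
  have hdv : ∀ t : ℝ, X + t • ((k1.d T0.B - k1.d T0.C) • T0.A + (k1.d T0.C - k1.d T0.A) • T0.B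
      + (k1.d T0.A - k1.d T0.B) • T0.C) ∈ T0.hull → k1.d (X + t • ((k1.d T0.B - k1.d T0.C) • T0.A
      + (k1.d T0.C - k1.d T0.A) • T0.B + (k1.d T0.A - k1.d T0.B) • T0.C)) = 0 := by
    intro t _
    have hr : X + t • ((k1.d T0.B - k1.d T0.C) • T0.A + (k1.d T0.C - k1.d T0.A) • T0.B
      + (k1.d T0.A - k1.d T0.B) • T0.C) = (k0.a X + t * (k1.d T0.B - k1.d T0.C)) • T0.A +
        (k0.b X + t * (k1.d T0.C - k1.d T0.A)) • T0.B +
        (k0.c X + t * (k1.d T0.A - k1.d T0.B)) • T0.C := by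
      nth_rewrite 1 [k0.recon X (d0 X x0)]
      module
    have e3 := k0.d_eq X (d0 X x0) k1.d k1.fd
    rw [d1 X x1] at e3
    rw [hr, k1.fd _ _ _ _ _ _ (by linear_combination k0.sum X)]
    linear_combination -e3
  obtain ⟨t, ht, hY⟩ := ray_exit k0 x0 hX0 (α := k1.d T0.B - k1.d T0.C)
    (β := k1.d T0.C - k1.d T0.A) (γ := k1.d T0.A - k1.d T0.B) (by ring)
    (fun h => hne ⟨by linarith [h.2.2], by linarith [h.1]⟩)
  obtain ⟨t', ht', hZ⟩ := ray_exit k0 x0 hX0 (α := -(k1.d T0.B - k1.d T0.C))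
    (β := -(k1.d T0.C - k1.d T0.A)) (γ := -(k1.d T0.A - k1.d T0.B)) (by ring)
    (fun h => hne ⟨by linarith [h.2.2], by linarith [h.1]⟩)
  have hneg : X + t' • (-(k1.d T0.B - k1.d T0.C) • T0.A + -(k1.d T0.C - k1.d T0.A) • T0.B
      + -(k1.d T0.A - k1.d T0.B) • T0.C) = X + (-t') • ((k1.d T0.B - k1.d T0.C) • T0.A
      + (k1.d T0.C - k1.d T0.A) • T0.B + (k1.d T0.A - k1.d T0.B) • T0.C) := by module
  rw [hneg] at hZ
  clear hneg
  generalize ((k1.d T0.B - k1.d T0.C) • T0.A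
      + (k1.d T0.C - k1.d T0.A) • T0.B + (k1.d T0.A - k1.d T0.B) • T0.C) = v at *
  have hY1 := stay _ (outline_sub_hull hY) (hdv _ (outline_sub_hull hY))
  have hZ1 := stay _ (outline_sub_hull hZ) (hdv _ (outline_sub_hull hZ))
  have hv : v ≠ 0 := by
    rintro rfl
    apply hX0
    simpa using hY
  refine ⟨X + t • v, X + (-t') • v, ?_, ?_⟩
  · intro h
    have : (t + t') • v = 0 := by
      have h2 := add_left_cancel h
      rw [add_smul, h2]; module
    rcases smul_eq_zero.1 this with h | h
    · linarith
    · exact hv h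
  · ext W
    constructor
    · rintro ⟨hW, hW1⟩
      obtain ⟨s, rfl⟩ := hline W (outline_sub_hull hW) hW1
      rcases lt_trichotomy s 0 with hs | hs | hs
      · right
        have m : ∀ r : ℝ, X + r • v = X + (-r) • (-v) := fun r => by module
        rcases lt_trichotomy (-s) t' with h | h | h
        · rw [m] at hW hZ
          rw [neg_neg] at hZ
          exact (ray_unique x0 hX0 (by linarith) h hW (outline_sub_hull hZ)).elim
        · rw [← h, neg_neg]; rfl
        · rw [m] at hW hZ
          rw [neg_neg] at hZ
          exact (ray_unique x0 hX0 ht' h hZ (outline_sub_hull hW)).elim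
      · subst hs
        exact absurd (by simpa using hW) hX0
      · left
        rcases lt_trichotomy s t with h | h | h
        · exact (ray_unique x0 hX0 hs h hW (outline_sub_hull hY)).elim
        · rw [h]
        · exact (ray_unique x0 hX0 ht h hY (outline_sub_hull hW)).elim
    · rintro (rfl | rfl)
      · exact ⟨hY, hY1⟩
      · exact ⟨hZ, hZ1⟩

theorem all_hull (T : Fin 3 → Tri) (e : Equiv.Perm (Fin 3)) :
    ((T (e 0)).hull ∩ (T (e 1)).hull ∩ (T (e 2)).hull).Nonempty ↔
    ((T 0).hull ∩ (T 1).hull ∩ (T 2).hull).Nonempty := by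
  have key : ∀ x, (x ∈ (T (e 0)).hull ∩ (T (e 1)).hull ∩ (T (e 2)).hull) ↔
      x ∈ (T 0).hull ∩ (T 1).hull ∩ (T 2).hull := by
    intro x
    have h1 : (x ∈ (T (e 0)).hull ∩ (T (e 1)).hull ∩ (T (e 2)).hull) ↔
        ∀ i, x ∈ (T (e i)).hull := by
      simp [Fin.forall_fin_succ, and_assoc]
    have h2 : (x ∈ (T 0).hull ∩ (T 1).hull ∩ (T 2).hull) ↔ ∀ i, x ∈ (T i).hull := by
      simp [Fin.forall_fin_succ, and_assoc]
    rw [h1, h2]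
    exact e.forall_congr_left (p := fun i => x ∈ (T (e i)).hull) |>.trans (by simp)
  exact exists_congr key

/-- A linking of three triangles is Borromean iff the triangles can be enumerated
`Λ0, Λ1, Λ2` so that `∂Λ1 ∩ ⟨Λ2⟩` and `∂Λ2 ∩ ⟨Λ0⟩` each consist of exactly two points,
`∂Λ1 ∩ ⟨Λ0⟩ = ∅`, and `⟨Λ0⟩ ∩ ⟨Λ1⟩ ∩ ⟨Λ2⟩ ≠ ∅`. -/
theorem stmt3 (T : Fin 3 → Tri) (hT : IsLinking T) :
    IsBorromean T ↔
    ∃ e : Equiv.Perm (Fin 3),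
      (∃ P Q : Pt, P ≠ Q ∧ (T (e 1)).outline ∩ (T (e 2)).hull = {P, Q}) ∧
      (∃ P Q : Pt, P ≠ Q ∧ (T (e 2)).outline ∩ (T (e 0)).hull = {P, Q}) ∧
      (T (e 1)).outline ∩ (T (e 0)).hull = ∅ ∧
      ((T (e 0)).hull ∩ (T (e 1)).hull ∩ (T (e 2)).hull).Nonempty := by
  constructor
  · rintro ⟨hX, e, he⟩
    refine ⟨e, he 1, he 2, ?_, (all_hull T e).2 hX⟩
    obtain ⟨P, Q, hPQ, h⟩ := he 0
    exact lemA (hT _ _ (e.injective.ne (by decide))) hPQ h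
  · rintro ⟨e, ⟨P, Q, hPQ, h12⟩, ⟨P', Q', hPQ', h20⟩, h10, hX⟩
    refine ⟨(all_hull T e).1 hX, e, ?_⟩
    obtain ⟨X, ⟨x0, x1⟩, x2⟩ := hX
    have h := lemB (hT _ _ (e.injective.ne (by decide))) (hT _ _ (e.injective.ne (by decide)))
      hPQ hPQ' h12 h20 h10 x0 x1 x2
    intro j
    fin_cases j
    · exact h
    · exact ⟨P, Q, hPQ, h12⟩
    · exact ⟨P', Q', hPQ', h20⟩
end
end
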